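/- Let p > 5 be a prime. Then there is no classical totally positive definite ternary quadratic form that is universal over O_p. -/

import Mathlib

open NumberField

/-- The maximal totally real subfield `K_q = ℚ(ζ_q + ζ_q⁻¹)` of the `q`-th cyclotomic field,
realized inside `ℝ` as `ℚ(2 cos(2π/q))`. -/
noncomputable def Kq (q : ℕ) : IntermediateField ℚ ℝ :=
  IntermediateField.adjoin ℚ {2 * Real.cos (2 * Real.pi / q)}

/-- An element `α` of the ring of integers of `K` is totally positive if `σ α > 0`
for every real embedding `σ : K →+* ℝ`. -/
def TotallyPositive (K : Type*) [Field K] (α : 𝓞 K) : Prop :=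
  ∀ σ : K →+* ℝ, 0 < σ (α : K)

/-- Evaluation `vᵀ M v` of the classical quadratic form with Gram matrix `M`. -/
def evalQF {R : Type*} [CommRing R] {n : ℕ} (M : Matrix (Fin n) (Fin n) R)
    (v : Fin n → R) : R :=
  ∑ i, ∑ j, v i * M i j * v j

section

open Finset

local notation "χ" => ZMod.stdAddChar

/-- The Fourier transform of an integer-valued function on `ℤ/p`. -/
noncomputable def intFourier {p : ℕ} [NeZero p] (a : ZMod p → ℤ) (t : ZMod p) : ℂ :=
  ∑ j, (a j : ℂ) * χ (t * j)

/-- The arithmetic of the ring of integers of `ℚ(ζ_p + ζ_p⁻¹)` seen through its real embeddings,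
which are indexed (twice each) by the nonzero residues `t` modulo `p`. -/
structure RealCyclotomic (p : ℕ) [NeZero p] (O : Type*) [CommRing O] where
  /-- The embedding sending `ζ_p + ζ_p⁻¹` to `2 cos (2πt/p)`, for `t ≠ 0`. -/
  emb : ZMod p → O →+* ℝ
  emb_injective : ∀ t, t ≠ 0 → Function.Injective (emb t)
  /-- The element `ζ_p + ζ_p⁻¹`. -/
  gen : O
  emb_gen : ∀ t, t ≠ 0 → (emb t gen : ℂ) = χ t + χ (-t)
  exists_coeff : ∀ x, ∃ a : ZMod p → ℤ, (∀ j, a (-j) = a j) ∧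
    ∀ t, t ≠ 0 → (emb t x : ℂ) = intFourier a t
  one_le_prod : ∀ x, x ≠ 0 → 1 ≤ ∏ t with t ≠ 0, |emb t x|
  dvd_of_isIntegral : ∀ t, t ≠ 0 → ∀ x y, y ≠ 0 → ∀ w : ℂ, IsIntegral ℤ w →
    (emb t x : ℂ) = emb t y * w → y ∣ x

section Fourier

variable {p : ℕ} [NeZero p]

/-- Parseval's identity for integer-valued functions on `ℤ/p`. -/
lemma sum_normSq_intFourier (a : ZMod p → ℤ) :
    ∑ t, Complex.normSq (intFourier a t) = p * ∑ j, (a j : ℝ) ^ 2 := by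
  have key : (∑ t, ((Complex.normSq (intFourier a t) : ℝ) : ℂ))
      = p * ∑ j, (a j : ℂ) ^ 2 := by
    have : ∀ t : ZMod p, ((Complex.normSq (intFourier a t) : ℝ) : ℂ)
        = ∑ j, ∑ k, (a j : ℂ) * a k * χ (t * (j - k)) := by
      intro t
      rw [intFourier, ← Complex.mul_conj, map_sum, Finset.sum_mul_sum]
      refine Finset.sum_congr rfl fun j _ => Finset.sum_congr rfl fun k _ => ?_
      rw [map_mul (starRingEnd ℂ), ← AddChar.map_neg_eq_conj, mul_sub, sub_eq_add_neg,
        AddChar.map_add_eq_mul]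
      simp only [map_intCast]; ring
    simp_rw [this]
    rw [Finset.sum_comm, Finset.mul_sum]
    refine Finset.sum_congr rfl fun j _ => ?_
    rw [Finset.sum_comm]
    simp_rw [← Finset.mul_sum, AddChar.sum_mulShift _ (ZMod.isPrimitive_stdAddChar p)]
    simp only [sub_eq_zero, ZMod.card]
    rw [Finset.sum_eq_single j (by intro b _ hb; simp [Ne.symm hb]) (by simp)]
    simp; ring
  exact_mod_cast key

lemma sum_intFourier_mul (a : ZMod p → ℤ) (i : ZMod p) :
    ∑ t, intFourier a t * χ (t * -i) = p * a i := by
  simp_rw [intFourier, Finset.sum_mul, mul_assoc, ← AddChar.map_add_eq_mul, ← mul_add]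
  rw [Finset.sum_comm]
  simp_rw [← Finset.mul_sum, AddChar.sum_mulShift _ (ZMod.isPrimitive_stdAddChar p)]
  simp only [← sub_eq_add_neg, sub_eq_zero, ZMod.card]
  rw [Finset.sum_eq_single i (by intro b _ hb; simp [hb]) (by simp)]
  simp; ring

/-- A function whose Fourier transform vanishes off `0` is constant. -/
lemma eq_of_intFourier_eq_zero (a : ZMod p → ℤ)
    (h : ∀ t, t ≠ 0 → intFourier a t = 0) (i j : ZMod p) : a i = a j := by
  have h1 : ∀ i, (p : ℂ) * a i = intFourier a 0 := by
    intro i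
    rw [← sum_intFourier_mul, Finset.sum_eq_single 0 (by intro b _ hb; simp [h b hb]) (by simp)]
    simp
  have hp : (p : ℂ) ≠ 0 := by exact_mod_cast NeZero.ne p
  exact_mod_cast mul_left_cancel₀ hp ((h1 i).trans (h1 j).symm)

lemma intFourier_add (a b : ZMod p → ℤ) (t : ZMod p) :
    intFourier (a + b) t = intFourier a t + intFourier b t := by
  simp [intFourier, add_mul, Finset.sum_add_distrib]

lemma intFourier_sub (a b : ZMod p → ℤ) (t : ZMod p) :
    intFourier (a - b) t = intFourier a t - intFourier b t := by
  simp [intFourier, sub_mul]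

/-- Convolution of integer-valued functions on `ℤ/p`. -/
def intConv (a b : ZMod p → ℤ) (j : ZMod p) : ℤ := ∑ k, a k * b (j - k)

lemma intFourier_intConv (a b : ZMod p → ℤ) (t : ZMod p) :
    intFourier (intConv a b) t = intFourier a t * intFourier b t := by
  simp only [intFourier, intConv, Int.cast_sum, Int.cast_mul, Finset.sum_mul]
  rw [Finset.sum_comm]
  refine Finset.sum_congr rfl fun k _ => ?_
  rw [Finset.mul_sum]
  refine Fintype.sum_equiv (Equiv.subRight k) _ _ fun j => ?_
  have : χ (t * j) = χ (t * k) * χ (t * (j - k)) := by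
    rw [← AddChar.map_add_eq_mul]; congr 1; ring
  simp only [Equiv.subRight_apply]
  rw [this]; ring

lemma intFourier_zero (a : ZMod p → ℤ) : intFourier a 0 = ((∑ j, a j : ℤ) : ℂ) := by
  simp [intFourier]

/-- Comparing Fourier transforms pointwise off `0` compares the norms of convolutions. -/
lemma sum_sq_intConv_lt {a b c m : ZMod p → ℤ} (hm : ∑ j, m j = 0) (hm0 : m ≠ 0)
    (h : ∀ t, t ≠ 0 → Complex.normSq (intFourier a t) <
      Complex.normSq (intFourier b t) + Complex.normSq (intFourier c t)) :
    ∑ j, intConv m a j ^ 2 < ∑ j, intConv m b j ^ 2 + ∑ j, intConv m c j ^ 2 := by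
  have hex : ∃ t, t ≠ 0 ∧ intFourier m t ≠ 0 := by
    by_contra! hcon
    have h1 := eq_of_intFourier_eq_zero m hcon
    have h2 : ∀ j, m j = 0 := by
      intro j
      have : ∑ k, m k = p * m j := by
        simp [fun k => h1 k j]
      rw [hm] at this
      rcases mul_eq_zero.1 this.symm with h | h
      · exact absurd h (by exact_mod_cast NeZero.ne p)
      · exact h
    exact hm0 (funext h2)
  have h0 : intFourier m 0 = 0 := by rw [intFourier_zero, hm]; simp
  have key : ∑ t, Complex.normSq (intFourier (intConv m a) t) <
      ∑ t, (Complex.normSq (intFourier (intConv m b) t) + Complex.normSq (intFourier (intConv m c) t)) := by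
    simp only [intFourier_intConv, map_mul, ← mul_add]
    obtain ⟨t, ht, hmt⟩ := hex
    refine Finset.sum_lt_sum (fun s _ => ?_) ⟨t, Finset.mem_univ _, ?_⟩
    · rcases eq_or_ne s 0 with rfl | hs
      · simp [h0]
      · exact mul_le_mul_of_nonneg_left (h s hs).le (Complex.normSq_nonneg _)
    · exact mul_lt_mul_of_pos_left (h t ht) (Complex.normSq_pos.2 hmt)
  rw [Finset.sum_add_distrib] at key
  simp only [sum_normSq_intFourier] at key
  rw [← mul_add] at key
  have hp : (0 : ℝ) < p := by exact_mod_cast Nat.pos_of_ne_zero (NeZero.ne p)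
  have := lt_of_mul_lt_mul_left key hp.le
  exact_mod_cast this

end Fourier

section Instance

variable {p : ℕ} [Fact p.Prime]

lemma isPrimitiveRoot_stdAddChar {t : ZMod p} (ht : t ≠ 0) : IsPrimitiveRoot (χ t) p := by
  refine IsPrimitiveRoot.mk_of_lt _ (Fact.out : p.Prime).pos ?_ fun l hl hlp h => ?_
  · rw [← AddChar.map_nsmul_eq_pow]; simp
  · rw [← AddChar.map_nsmul_eq_pow] at h
    have h1 : l • t = 0 := ZMod.injective_stdAddChar (h.trans (AddChar.map_zero_eq_one _).symm)
    rw [nsmul_eq_mul, mul_eq_zero] at h1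
    rcases h1 with h1 | h1
    · rw [ZMod.natCast_eq_zero_iff] at h1
      exact absurd (Nat.le_of_dvd hl h1) (not_le.2 hlp)
    · exact ht h1

lemma exists_stdAddChar_of_isPrimitiveRoot {z : ℂ} (hz : IsPrimitiveRoot z p) :
    ∃ t : ZMod p, t ≠ 0 ∧ χ t = z := by
  have hp := (Fact.out : p.Prime)
  obtain ⟨i, -, hi⟩ := (isPrimitiveRoot_stdAddChar (one_ne_zero (α := ZMod p))).eq_pow_of_pow_eq_one
    hz.pow_eq_one
  rw [← AddChar.map_nsmul_eq_pow] at hi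
  refine ⟨_, ?_, hi⟩
  intro h0
  rw [h0, AddChar.map_zero_eq_one] at hi
  exact hz.ne_one hp.one_lt hi.symm

lemma stdAddChar_one_add_neg :
    (χ (1 : ZMod p) + χ (-1 : ZMod p) : ℂ) = ((2 * Real.cos (2 * Real.pi / p) : ℝ) : ℂ) := by
  have h1 := ZMod.stdAddChar_coe (N := p) 1
  have h2 := ZMod.stdAddChar_coe (N := p) (-1)
  push_cast at h1 h2
  rw [h1, h2]
  push_cast
  rw [Complex.two_cos]
  congr 2 <;> ring

variable {F : Type*} [Field F] [CharZero F] [IsCyclotomicExtension {p} ℚ F] {ζ : F}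

/-- The embeddings of the cyclotomic field into `ℂ`, with prescribed image of the root of unity. -/
lemma exists_cyclotomic_embedding (hζ : IsPrimitiveRoot ζ p) :
    ∃ φ : ZMod p → (F →ₐ[ℚ] ℂ), ∀ t, t ≠ 0 → φ t ζ = χ t := by
  have hirr : Irreducible (Polynomial.cyclotomic p ℚ) :=
    Polynomial.cyclotomic.irreducible_rat (Fact.out : p.Prime).pos
  have : ∀ t : ZMod p, ∃ f : F →ₐ[ℚ] ℂ, t ≠ 0 → f ζ = χ t := by
    intro t
    by_cases ht : t = 0
    · have := IsCyclotomicExtension.finiteDimensional {p} ℚ F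
      exact ⟨IsAlgClosed.lift, fun h => absurd ht h⟩
    · refine ⟨(hζ.embeddingsEquivPrimitiveRoots ℂ hirr).symm ⟨χ t, ?_⟩, fun _ => ?_⟩
      · rw [mem_primitiveRoots (Fact.out : p.Prime).pos]
        exact isPrimitiveRoot_stdAddChar ht
      · rw [← IsPrimitiveRoot.embeddingsEquivPrimitiveRoots_apply_coe hζ ℂ hirr]
        simp
  choose φ hφ using this
  exact ⟨φ, hφ⟩

lemma cyclotomic_algHom_ext (hζ : IsPrimitiveRoot ζ p) {R : Type*} [CommRing R] [Algebra ℚ R]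
    {f g : F →ₐ[ℚ] R} (h : f ζ = g ζ) : f = g :=
  (hζ.powerBasis ℚ).algHom_ext (by simpa using h)

omit [IsCyclotomicExtension {p} ℚ F] in
/-- `K_p` sits inside the cyclotomic field. -/
lemma exists_Kq_to_cyclotomic (f : F →ₐ[ℚ] ℂ) (hf : f ζ = χ (1 : ZMod p)) :
    ∃ ι : Kq p →ₐ[ℚ] F, ∀ k : Kq p, f (ι k) = ((k : ℝ) : ℂ) := by
  let c : ℝ →ₐ[ℚ] ℂ := Complex.ofRealAm.restrictScalars ℚ
  have hle : (Kq p).map c ≤ f.fieldRange := by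
    rw [Kq, IntermediateField.adjoin_map, IntermediateField.adjoin_le_iff]
    rintro _ ⟨_, rfl, rfl⟩
    refine ⟨ζ + ζ⁻¹, ?_⟩
    change f (ζ + ζ⁻¹) = ((2 * Real.cos (2 * Real.pi / p) : ℝ) : ℂ)
    rw [map_add, map_inv₀, hf, ← stdAddChar_one_add_neg, AddChar.map_neg_eq_inv]
  have hmem : ∀ k : Kq p, c k ∈ f.range := fun k => hle ⟨k, k.2, rfl⟩
  let g : Kq p →ₐ[ℚ] f.range := (c.comp (Kq p).val).codRestrict f.range hmem
  refine ⟨((AlgEquiv.ofInjectiveField f).symm : f.range →ₐ[ℚ] F).comp g, fun k => ?_⟩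
  have := AlgEquiv.apply_symm_apply (AlgEquiv.ofInjectiveField f) (g k)
  exact congrArg Subtype.val this

/-- Integers of the cyclotomic field are polynomials in the root of unity. -/
lemma exists_aeval_of_isIntegral (hζ : IsPrimitiveRoot ζ p) {x : F} (hx : IsIntegral ℤ x) :
    ∃ P : Polynomial ℤ, Polynomial.aeval ζ P = x := by
  have := IsCyclotomicExtension.Rat.isIntegralClosure_adjoin_singleton_of_prime (p := p) hζ
  obtain ⟨y, hy⟩ := (IsIntegralClosure.isIntegral_iff (A := Algebra.adjoin ℤ {ζ})).1 hx
  obtain ⟨P, hP⟩ := (Algebra.adjoin_singleton_eq_range_aeval ℤ ζ).le y.2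
  exact ⟨P, hP.trans hy⟩

/-- Values of an integer polynomial at `p`-th roots of unity form a Fourier transform. -/
lemma exists_intFourier_eq_aeval (P : Polynomial ℤ) :
    ∃ a : ZMod p → ℤ, ∀ t, Polynomial.aeval (χ t : ℂ) P = intFourier a t := by
  induction P using Polynomial.induction_on' with
  | add P Q hP hQ =>
    obtain ⟨a, ha⟩ := hP
    obtain ⟨b, hb⟩ := hQ
    refine ⟨a + b, fun t => ?_⟩
    rw [map_add, ha, hb, intFourier_add]
  | monomial n c =>
    refine ⟨Pi.single (n : ZMod p) c, fun t => ?_⟩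
    rw [Polynomial.aeval_monomial, intFourier, Finset.sum_eq_single (n : ZMod p)]
    · rw [← AddChar.map_nsmul_eq_pow, nsmul_eq_mul, mul_comm (n : ZMod p) t]
      simp
    · intro b _ hb
      simp [Pi.single_eq_of_ne hb]
    · simp

lemma one_le_prod_embedding (hζ : IsPrimitiveRoot ζ p) (φ : ZMod p → (F →ₐ[ℚ] ℂ))
    (hφ : ∀ t, t ≠ 0 → φ t ζ = χ t) {x : F} (hx : IsIntegral ℤ x) (hx0 : x ≠ 0) :
    1 ≤ ∏ t with t ≠ 0, ‖φ t x‖ := by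
  have := IsCyclotomicExtension.finiteDimensional {p} ℚ F
  have h1 := Algebra.norm_eq_prod_embeddings ℚ ℂ x
  have h2 : ∏ σ : F →ₐ[ℚ] ℂ, σ x = ∏ t with t ≠ 0, φ t x := by
    symm
    refine Finset.prod_bij (fun t _ => φ t) (by simp) ?_ ?_ (by simp)
    · intro s hs t ht h
      simp only [mem_filter, mem_univ, true_and] at hs ht
      apply ZMod.injective_stdAddChar
      rw [← hφ s hs, ← hφ t ht, h]
    · intro σ _
      obtain ⟨t, ht, h⟩ := exists_stdAddChar_of_isPrimitiveRoot
        (hζ.map_of_injective (f := σ) σ.injective)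
      refine ⟨t, by simpa using ht, cyclotomic_algHom_ext hζ ?_⟩
      rw [hφ t ht, h]
  obtain ⟨n, hn⟩ := IsIntegrallyClosed.isIntegral_iff.1 (Algebra.isIntegral_norm ℚ hx)
  rw [← hn, h2] at h1
  have hn0 : n ≠ 0 := by
    rintro rfl
    rw [map_zero] at hn
    exact hx0 (Algebra.norm_eq_zero_iff.1 hn.symm)
  rw [← norm_prod, ← h1]
  have : (1 : ℤ) ≤ |n| := Int.one_le_abs hn0
  simp
  exact_mod_cast this

omit [Fact p.Prime] in
lemma Kq_algHom_ext {R : Type*} [Field R] [Algebra ℚ R] {f g : Kq p →ₐ[ℚ] R}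
    (h : f (IntermediateField.AdjoinSimple.gen ℚ (2 * Real.cos (2 * Real.pi / p))) =
      g (IntermediateField.AdjoinSimple.gen ℚ (2 * Real.cos (2 * Real.pi / p)))) : f = g :=
  IntermediateField.algHom_ext_of_eq_adjoin ℚ rfl (by
    rintro _ rfl
    exact h)

variable (p) in
/-- The ring of integers of `K_p` with its real embeddings. -/
theorem exists_realCyclotomic : ∃ R : RealCyclotomic p (𝓞 (Kq p)),
    ∀ α, TotallyPositive (Kq p) α ↔ ∀ t, t ≠ 0 → 0 < R.emb t α := by
  have : NeZero ((p : ℕ) : ℚ) := NeZero.charZero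
  have : IsCyclotomicExtension {p} ℚ (CyclotomicField p ℚ) :=
    CyclotomicField.isCyclotomicExtension p ℚ
  have hζ := IsCyclotomicExtension.zeta_spec p ℚ (CyclotomicField p ℚ)
  set F := CyclotomicField p ℚ with hF
  set ζ := IsCyclotomicExtension.zeta p ℚ F with hζdef
  obtain ⟨φ, hφ⟩ := exists_cyclotomic_embedding hζ
  obtain ⟨ι, hι⟩ := exists_Kq_to_cyclotomic (φ 1) (hφ 1 one_ne_zero)
  let θ : Kq p := IntermediateField.AdjoinSimple.gen ℚ (2 * Real.cos (2 * Real.pi / p))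
  have hιθ : ι θ = ζ + ζ⁻¹ := by
    apply (φ 1).injective
    change φ 1 (ι θ) = φ 1 (ζ + ζ⁻¹)
    rw [hι, map_add, map_inv₀, hφ 1 one_ne_zero, ← AddChar.map_neg_eq_inv,
      stdAddChar_one_add_neg]
    rfl
  have hφθ : ∀ t, t ≠ 0 → φ t (ι θ) = χ t + χ (-t) := by
    intro t ht
    rw [hιθ, map_add, map_inv₀, hφ t ht, ← AddChar.map_neg_eq_inv]
  have hreal : ∀ t, t ≠ 0 → ∀ k, starRingEnd ℂ (φ t (ι k)) = φ t (ι k) := by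
    intro t ht k
    let c : ℂ →ₐ[ℚ] ℂ := (Complex.conjAe : ℂ →ₐ[ℝ] ℂ).restrictScalars ℚ
    have : c.comp ((φ t).comp ι) = (φ t).comp ι := by
      apply Kq_algHom_ext
      change starRingEnd ℂ (φ t (ι θ)) = φ t (ι θ)
      rw [hφθ t ht, map_add, ← AddChar.map_neg_eq_conj, ← AddChar.map_neg_eq_conj, neg_neg, add_comm]
    exact DFunLike.congr_fun this k
  have hemb : ∀ t, ∃ e : Kq p →+* ℝ, t ≠ 0 → ∀ k, ((e k : ℝ) : ℂ) = φ t (ι k) := by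
    intro t
    by_cases ht : t = 0
    · exact ⟨(Kq p).subtype, fun h => absurd ht h⟩
    · have hr : ComplexEmbedding.IsReal (((φ t).comp ι : Kq p →ₐ[ℚ] ℂ) : Kq p →+* ℂ) := by
        ext k
        exact hreal t ht k
      exact ⟨hr.embedding, fun _ k => ComplexEmbedding.IsReal.coe_embedding_apply hr k⟩
  choose e he using hemb
  have hθint : IsIntegral ℤ θ := by
    refine (isIntegral_algHom_iff (ι.restrictScalars ℤ) ι.injective).1 ?_
    change IsIntegral ℤ (ι θ)
    rw [hιθ]
    have := hζ.isIntegral (Fact.out : p.Prime).pos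
    have h2 := hζ.inv.isIntegral (Fact.out : p.Prime).pos
    exact this.add h2
  let R : RealCyclotomic p (𝓞 (Kq p)) :=
    { emb := fun t => (e t).comp (algebraMap (𝓞 (Kq p)) (Kq p))
      emb_injective := fun t _ => (e t).injective.comp RingOfIntegers.coe_injective
      gen := ⟨θ, hθint⟩
      emb_gen := fun t ht => (he t ht θ).trans (hφθ t ht)
      exists_coeff := by
        intro x
        have hx : IsIntegral ℤ (ι (x : Kq p)) := x.2.map (ι.restrictScalars ℤ)
        obtain ⟨P, hP⟩ := exists_aeval_of_isIntegral hζ hx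
        obtain ⟨a, ha⟩ := exists_intFourier_eq_aeval (p := p) P
        have hxa : ∀ t, t ≠ 0 → φ t (ι x) = intFourier a t := by
          intro t ht
          rw [← ha, ← hP, ← hφ t ht]
          exact (Polynomial.aeval_algHom_apply ((φ t).restrictScalars ℤ) ζ P).symm
        refine ⟨a, fun j => ?_, fun t ht => (he t ht x).trans (hxa t ht)⟩
        have := eq_of_intFourier_eq_zero (fun j => a (-j) - a j) (fun t ht => ?_) j 0
        · simp at this
          omega
        · have h1 := hreal t ht x
          rw [hxa t ht] at h1
          have h2 : starRingEnd ℂ (intFourier a t) = intFourier (fun j => a (-j)) t := by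
            simp only [intFourier, map_sum, map_mul, map_intCast, ← AddChar.map_neg_eq_conj]
            refine Fintype.sum_equiv (Equiv.neg _) _ _ fun j => ?_
            simp
          rw [h2] at h1
          have h3 : intFourier (fun j => a (-j) - a j) t
              = intFourier (fun j => a (-j)) t - intFourier a t := by
            simp [intFourier, sub_mul]
          rw [h3, h1, sub_self]
      one_le_prod := by
        intro x hx
        have hx' : IsIntegral ℤ (ι (x : Kq p)) := x.2.map (ι.restrictScalars ℤ)
        have h0 : ι (x : Kq p) ≠ 0 := by
          simpa using hx
        refine (one_le_prod_embedding hζ φ hφ hx' h0).trans_eq ?_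
        refine Finset.prod_congr rfl fun t ht => ?_
        have ht : t ≠ 0 := by simpa using ht
        rw [← he t ht, Complex.norm_real]
        rfl
      dvd_of_isIntegral := by
        intro t ht x y hy w hw hxy
        have hy0 : (y : Kq p) ≠ 0 := by simpa using hy
        have hint : IsIntegral ℤ ((x : Kq p) / y) := by
          let f : Kq p →ₐ[ℚ] ℂ := (φ t).comp ι
          refine (isIntegral_algHom_iff (f.restrictScalars ℤ) f.injective).1 ?_
          change IsIntegral ℤ (f ((x : Kq p) / y))
          have hfy : f y ≠ 0 := by simpa using hy0
          have : f ((x : Kq p) / y) = w := by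
            rw [map_div₀, div_eq_iff hfy, mul_comm]
            have h1 := he t ht x
            have h2 := he t ht y
            change _ = f x at h1
            change _ = f y at h2
            rw [← h1, ← h2]
            exact hxy
          rwa [this]
        refine ⟨⟨_, hint⟩, ?_⟩
        apply RingOfIntegers.coe_injective
        change (x : Kq p) = y * (x / y)
        field_simp }
  refine ⟨R, fun α => ⟨fun h t _ => h (e t), fun h σ => ?_⟩⟩
  have hfin := IsCyclotomicExtension.finiteDimensional {p} ℚ F
  let a1 : Algebra (Kq p) F := ι.toRingHom.toAlgebra
  let a2 : Algebra (Kq p) ℂ := ((algebraMap ℝ ℂ).comp σ).toAlgebra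
  have : IsScalarTower ℚ (Kq p) F := IsScalarTower.of_algebraMap_eq fun x => (ι.commutes x).symm
  have : Algebra.IsAlgebraic (Kq p) F := Algebra.IsAlgebraic.tower_top (K := ℚ) (Kq p)
  let Φ : F →ₐ[Kq p] ℂ := IsAlgClosed.lift
  obtain ⟨t, ht, hΦ⟩ := exists_stdAddChar_of_isPrimitiveRoot
    (hζ.map_of_injective (f := Φ) Φ.toRingHom.injective)
  have hΦφ : Φ.toRingHom.toRatAlgHom = φ t := by
    apply cyclotomic_algHom_ext hζ
    rw [hφ t ht, hΦ]
    rfl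
  have h1 : ((σ α : ℝ) : ℂ) = φ t (ι α) := by
    rw [← hΦφ]
    exact (Φ.commutes (α : Kq p)).symm
  rw [← he t ht] at h1
  have h2 : σ α = e t α := by exact_mod_cast h1
  rw [h2]
  exact h t ht

end Instance

namespace RealCyclotomic

variable {p : ℕ} [Fact p.Prime] {O : Type*} [CommRing O] (R : RealCyclotomic p O)

lemma ext_emb {x y : O} (h : ∀ t, t ≠ 0 → R.emb t x = R.emb t y) : x = y :=
  R.emb_injective 1 one_ne_zero (h 1 one_ne_zero)

lemma ext_emb_complex {x y : O} (h : ∀ t, t ≠ 0 → (R.emb t x : ℂ) = R.emb t y) : x = y :=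
  R.ext_emb fun t ht => by exact_mod_cast h t ht

/-- The elements `ζ ^ n + ζ ^ (-n)`. -/
def E : ℕ → O
  | 0 => 2
  | 1 => R.gen
  | n + 2 => R.gen * E (n + 1) - E n

lemma emb_E {t : ZMod p} (ht : t ≠ 0) (n : ℕ) :
    (R.emb t (R.E n) : ℂ) = χ (t * (n : ZMod p)) + χ (-(t * (n : ZMod p))) := by
  induction n using Nat.twoStepInduction with
  | zero => simp [E, one_add_one_eq_two, map_ofNat (R.emb t) 2]
  | one => simpa [E] using R.emb_gen t ht
  | more n h1 h2 =>
    rw [E, map_sub, map_mul, Complex.ofReal_sub, Complex.ofReal_mul, h1, h2, R.emb_gen t ht]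
    have e1 : χ (t * ((n + 2 : ℕ) : ZMod p)) = χ t * χ (t * ((n + 1 : ℕ) : ZMod p)) := by
      rw [← AddChar.map_add_eq_mul]; congr 1; push_cast; ring
    have e2 : χ (-(t * ((n + 2 : ℕ) : ZMod p))) = χ (-t) * χ (-(t * ((n + 1 : ℕ) : ZMod p))) := by
      rw [← AddChar.map_add_eq_mul]; congr 1; push_cast; ring
    have e3 : χ (t * (n : ZMod p)) = χ (-t) * χ (t * ((n + 1 : ℕ) : ZMod p)) := by
      rw [← AddChar.map_add_eq_mul]; congr 1; push_cast; ring
    have e4 : χ (-(t * (n : ZMod p))) = χ t * χ (-(t * ((n + 1 : ℕ) : ZMod p))) := by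
      rw [← AddChar.map_add_eq_mul]; congr 1; push_cast; ring
    rw [e1, e2, e3, e4]
    ring

lemma E_congr {m n : ℕ} (h : (m : ZMod p) = n ∨ (m : ZMod p) = -n) : R.E m = R.E n := by
  refine R.ext_emb_complex fun t ht => ?_
  rw [R.emb_E ht, R.emb_E ht]
  rcases h with h | h
  · rw [h]
  · rw [h, mul_neg, neg_neg, add_comm]

lemma E_mul_E (m n : ℕ) : R.E (m + n) * R.E m = R.E (2 * m + n) + R.E n := by
  refine R.ext_emb_complex fun t ht => ?_
  rw [map_mul, map_add, Complex.ofReal_mul, Complex.ofReal_add]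
  simp only [R.emb_E ht]
  rw [add_mul, mul_add, mul_add]
  simp only [← AddChar.map_add_eq_mul]
  push_cast
  ring_nf

/-- Replace `ζ` by `ζ ^ k`. -/
def reindex (k : ℕ) (hk : (k : ZMod p) ≠ 0) : RealCyclotomic p O where
  emb t := R.emb (t * (k : ZMod p)⁻¹)
  emb_injective t ht := R.emb_injective _ (mul_ne_zero ht (inv_ne_zero hk))
  gen := R.E k
  emb_gen t ht := by
    rw [R.emb_E (mul_ne_zero ht (inv_ne_zero hk)), mul_assoc, inv_mul_cancel₀ hk, mul_one]
  exists_coeff x := by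
    obtain ⟨a, ha, h⟩ := R.exists_coeff x
    refine ⟨fun j => a ((k : ZMod p) * j), fun j => ?_, fun t ht => ?_⟩
    · change a ((k : ZMod p) * -j) = a ((k : ZMod p) * j)
      rw [mul_neg, ha]
    · rw [h _ (mul_ne_zero ht (inv_ne_zero hk)), intFourier, intFourier]
      refine (Fintype.sum_equiv (Equiv.mulLeft₀ _ hk) _ _ fun j => ?_).symm
      change (a ((k : ZMod p) * j) : ℂ) * χ (t * j) =
        a ((k : ZMod p) * j) * χ (t * (k : ZMod p)⁻¹ * ((k : ZMod p) * j))
      congr 2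
      field_simp
  one_le_prod x hx := by
    refine (R.one_le_prod x hx).trans_eq (Finset.prod_bij (fun t _ => t * (k : ZMod p)) ?_ ?_ ?_ ?_)
    · intro t ht
      simp only [mem_filter, mem_univ, true_and] at ht ⊢
      exact mul_ne_zero ht hk
    · intro s _ t _ h
      exact mul_right_cancel₀ hk h
    · intro t ht
      simp only [mem_filter, mem_univ, true_and] at ht
      exact ⟨t * (k : ZMod p)⁻¹, by simpa using ⟨ht, by simpa using hk⟩, by field_simp⟩
    · intro t _
      rw [mul_assoc, mul_inv_cancel₀ hk, mul_one]
  dvd_of_isIntegral t ht := R.dvd_of_isIntegral _ (mul_ne_zero ht (inv_ne_zero hk))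

lemma forall_emb_reindex {k : ℕ} (hk : (k : ZMod p) ≠ 0) {P : (O →+* ℝ) → Prop} :
    (∀ t, t ≠ 0 → P ((R.reindex k hk).emb t)) ↔ ∀ t, t ≠ 0 → P (R.emb t) := by
  constructor
  · intro h t ht
    have := h (t * (k : ZMod p)) (mul_ne_zero ht hk)
    simp only [reindex] at this
    rwa [mul_assoc, mul_inv_cancel₀ hk, mul_one] at this
  · intro h t ht
    exact h _ (mul_ne_zero ht (inv_ne_zero hk))

/-! ### Sizes of the embeddings -/

/-- The generator of the prime above `p`. -/
def unif : O := 2 - R.gen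

lemma emb_unif {t : ZMod p} (ht : t ≠ 0) : R.emb t R.unif = Complex.normSq (1 - χ t) := by
  have : (R.emb t R.unif : ℂ) = (Complex.normSq (1 - χ t) : ℝ) := by
    rw [unif, map_sub, Complex.ofReal_sub, R.emb_gen t ht, ← Complex.mul_conj, map_sub, map_one,
      ← AddChar.map_neg_eq_conj, mul_sub, sub_mul, sub_mul, ← AddChar.map_add_eq_mul, add_neg_cancel,
      AddChar.map_zero_eq_one]
    simp only [map_ofNat, Complex.ofReal_ofNat]; ring
  exact_mod_cast this

lemma emb_two_add_gen {t : ZMod p} (ht : t ≠ 0) :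
    R.emb t (2 + R.gen) = Complex.normSq (1 + χ t) := by
  have : (R.emb t (2 + R.gen) : ℂ) = (Complex.normSq (1 + χ t) : ℝ) := by
    rw [map_add, Complex.ofReal_add, R.emb_gen t ht, ← Complex.mul_conj, map_add, map_one,
      ← AddChar.map_neg_eq_conj, mul_add, add_mul, add_mul, ← AddChar.map_add_eq_mul, add_neg_cancel,
      AddChar.map_zero_eq_one]
    simp only [map_ofNat, Complex.ofReal_ofNat]; ring
  exact_mod_cast this

lemma emb_unif_pos {t : ZMod p} (ht : t ≠ 0) : 0 < R.emb t R.unif := by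
  rw [R.emb_unif ht]
  exact Complex.normSq_pos.2
    (sub_ne_zero.2 ((isPrimitiveRoot_stdAddChar ht).ne_one (Fact.out : p.Prime).one_lt).symm)

lemma emb_gen_lt {t : ZMod p} (ht : t ≠ 0) : R.emb t R.gen < 2 := by
  have := R.emb_unif_pos ht
  rw [unif, map_sub, map_ofNat] at this
  linarith

lemma neg_two_le_emb_gen {t : ZMod p} (ht : t ≠ 0) : -2 ≤ R.emb t R.gen := by
  have := R.emb_two_add_gen ht
  have h2 := Complex.normSq_nonneg (1 + χ t)
  rw [map_add, map_ofNat] at this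
  linarith

lemma emb_unif_le {t : ZMod p} (ht : t ≠ 0) : R.emb t R.unif ≤ 4 := by
  have := R.neg_two_le_emb_gen ht
  rw [unif, map_sub, map_ofNat]
  linarith

lemma prod_emb_unif : ∏ t with t ≠ 0, R.emb t R.unif = (p : ℝ) ^ 2 := by
  have hp := (Fact.out : p.Prime)
  have h1 : ∏ t : ZMod p with t ≠ 0, (1 - χ t : ℂ) = p := by
    obtain ⟨n, hn⟩ : ∃ n, p = n + 1 := ⟨p - 1, by have := hp.pos; omega⟩
    have hprim := isPrimitiveRoot_stdAddChar (one_ne_zero (α := ZMod p))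
    have key : ∏ k ∈ range n, (1 - χ (1 : ZMod p) ^ (k + 1)) = n + 1 := by
      refine IsPrimitiveRoot.prod_one_sub_pow_eq_order ?_
      rw [← hn]; exact hprim
    have : (p : ℂ) = n + 1 := by rw [hn]; push_cast; rfl
    rw [this, ← key]
    symm
    refine Finset.prod_bij (fun k _ => ((k + 1 : ℕ) : ZMod p)) ?_ ?_ ?_ ?_
    · intro k hk
      simp only [mem_range] at hk
      simp only [mem_filter, mem_univ, true_and, ne_eq, ZMod.natCast_eq_zero_iff]
      intro hd
      have := Nat.le_of_dvd (by omega) hd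
      omega
    · intro k hk l hl h
      simp only [mem_range] at hk hl
      rw [ZMod.natCast_eq_natCast_iff, Nat.ModEq, Nat.mod_eq_of_lt (by omega),
        Nat.mod_eq_of_lt (by omega)] at h
      omega
    · intro t ht
      simp only [mem_filter, mem_univ, true_and] at ht
      have h1 : t.val ≠ 0 := by rwa [ne_eq, ZMod.val_eq_zero]
      have h2 := t.val_lt
      refine ⟨t.val - 1, by simp only [mem_range]; omega, ?_⟩
      rw [Nat.sub_add_cancel (by omega), ZMod.natCast_zmod_val]
    · intro k _
      rw [← AddChar.map_nsmul_eq_pow, nsmul_eq_mul, mul_one]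
  rw [Finset.prod_congr rfl fun t ht => R.emb_unif (by simpa using ht), ← map_prod, h1]
  simp [sq]

lemma card_filter_ne_zero : #{t : ZMod p | t ≠ 0} = p - 1 := by
  rw [Finset.filter_ne', Finset.card_erase_of_mem (mem_univ _), Finset.card_univ, ZMod.card]

/-- An integer that is small compared with a power of `unif` vanishes. -/
lemma eq_zero_of_abs_emb_le {y : O} {k : ℕ} {C : ℝ} (hC : 0 < C)
    (h : ∀ t, t ≠ 0 → |R.emb t y| ≤ R.emb t R.unif ^ k / C)
    (hpC : (p : ℝ) ^ (2 * k) < C ^ (p - 1)) : y = 0 := by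
  by_contra hy
  have h1 := R.one_le_prod y hy
  have h2 : ∏ t with t ≠ 0, |R.emb t y| ≤ ∏ t with t ≠ 0, (R.emb t R.unif ^ k / C) :=
    Finset.prod_le_prod (fun _ _ => abs_nonneg _) fun t ht => h t (by simpa using ht)
  rw [Finset.prod_div_distrib, Finset.prod_pow, R.prod_emb_unif, Finset.prod_const,
    card_filter_ne_zero, ← pow_mul] at h2
  have h3 := h1.trans h2
  rw [le_div_iff₀ (pow_pos hC _)] at h3
  linarith

lemma eq_zero_of_abs_emb_lt_one {y : O} (h : ∀ t, t ≠ 0 → |R.emb t y| < 1) : y = 0 := by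
  by_contra hy
  have h1 := R.one_le_prod y hy
  have h2 : ∏ t with t ≠ 0, |R.emb t y| < ∏ t : ZMod p with t ≠ 0, 1 := by
    refine Finset.prod_lt_prod_of_nonempty (fun t ht => ?_) (fun t ht => ?_) ⟨1, by simp⟩
    · have ht : t ≠ 0 := by simpa using ht
      have : R.emb t y ≠ 0 := fun h0 => hy (R.emb_injective t ht (by simpa using h0))
      positivity
    · exact h t (by simpa using ht)
  rw [Finset.prod_const_one] at h2
  linarith

lemma prod_abs_emb_of_mul_eq_one {x y : O} (h : x * y = 1) :
    ∏ t with t ≠ 0, |R.emb t x| = 1 := by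
  have h0 : (1 : O) ≠ 0 := fun h10 => by
    have := congrArg (R.emb 1) h10
    simp at this
  have hx : x ≠ 0 := by rintro rfl; exact h0 (by rw [← h, zero_mul])
  have hy : y ≠ 0 := by rintro rfl; exact h0 (by rw [← h, mul_zero])
  have h1 := R.one_le_prod x hx
  have h2 := R.one_le_prod y hy
  have h3 : (∏ t with t ≠ 0, |R.emb t x|) * ∏ t with t ≠ 0, |R.emb t y| = 1 := by
    rw [← Finset.prod_mul_distrib]
    refine Finset.prod_eq_one fun t _ => ?_
    rw [← abs_mul, ← map_mul, h, map_one, abs_one]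
  nlinarith

lemma intCast_injective (R : RealCyclotomic p O) {m n : ℤ} (h : (m : O) = n) : m = n := by
  have := congrArg (R.emb 1) h
  simpa using this

lemma natCast_not_isUnit (R : RealCyclotomic p O) {m : ℕ} (hm : 2 ≤ m) : ¬ IsUnit (m : O) := by
  intro h
  obtain ⟨y, hy⟩ := h.exists_right_inv
  have h1 := R.prod_abs_emb_of_mul_eq_one hy
  simp only [map_natCast, Nat.abs_cast, prod_const, card_filter_ne_zero] at h1
  have := (Fact.out : p.Prime).two_le
  have h2 : (1 : ℝ) < (m : ℝ) ^ (p - 1) := one_lt_pow₀ (by exact_mod_cast hm) (by omega)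
  linarith

lemma unif_not_isUnit : ¬ IsUnit R.unif := by
  intro h
  obtain ⟨y, hy⟩ := h.exists_right_inv
  have h1 := R.prod_abs_emb_of_mul_eq_one hy
  rw [Finset.prod_congr rfl fun t ht => abs_of_pos (R.emb_unif_pos (by simpa using ht)),
    R.prod_emb_unif] at h1
  have := (Fact.out : p.Prime).two_le
  have h2 : (2 : ℝ) ≤ p := by exact_mod_cast this
  nlinarith

/-! ### The Frobenius congruence -/

/-- If `q` divides `x ^ q` then `q` divides `x`: the prime `q ≠ p` is unramified. -/
lemma natCast_dvd_of_dvd_pow (R : RealCyclotomic p O) {q : ℕ} (hq : q.Prime) (hqp : q ≠ p) {x : O}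
    (h : (q : O) ∣ x ^ q) : (q : O) ∣ x := by
  obtain ⟨z, hz⟩ := h
  have : Fact q.Prime := ⟨hq⟩
  obtain ⟨a, -, ha⟩ := R.exists_coeff x
  let P : Polynomial ℤ := ∑ j : ZMod p, Polynomial.monomial j.val (a j)
  have hP : ∀ t : ZMod p, Polynomial.aeval (χ t : ℂ) P = intFourier a t := by
    intro t
    rw [map_sum, intFourier]
    refine Finset.sum_congr rfl fun j _ => ?_
    rw [Polynomial.aeval_monomial, ← AddChar.map_nsmul_eq_pow, nsmul_eq_mul,
      ZMod.natCast_zmod_val, mul_comm j t]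
    simp
  obtain ⟨S, hS⟩ : Polynomial.C (q : ℤ) ∣ Polynomial.expand ℤ q P - P ^ q := by
    rw [Polynomial.C_dvd_iff_dvd_coeff]
    intro i
    rw [← ZMod.intCast_zmod_eq_zero_iff_dvd, ← eq_intCast (Int.castRingHom (ZMod q)),
      ← Polynomial.coeff_map, Polynomial.map_sub, Polynomial.map_expand, Polynomial.map_pow,
      ZMod.expand_card, sub_self, Polynomial.coeff_zero]
  have hq0 : (q : ZMod p) ≠ 0 := by
    rw [ne_eq, ZMod.natCast_eq_zero_iff, Nat.prime_dvd_prime_iff_eq (Fact.out : p.Prime) hq]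
    exact hqp.symm
  have h1 := congrArg (Polynomial.aeval (χ (1 : ZMod p) : ℂ)) hS
  rw [map_sub, Polynomial.expand_aeval, ← AddChar.map_nsmul_eq_pow, nsmul_eq_mul, mul_one, hP,
    map_pow, hP, ← ha _ hq0, ← ha _ one_ne_zero, map_mul, Polynomial.aeval_C] at h1
  have h2 : ((R.emb 1 x : ℝ) : ℂ) ^ q = q * R.emb 1 z := by
    have := congrArg (R.emb 1) hz
    rw [map_pow, map_mul, map_natCast] at this
    exact_mod_cast this
  refine R.dvd_of_isIntegral _ hq0 x q ?_ (R.emb 1 z + Polynomial.aeval (χ (1 : ZMod p) : ℂ) S) ?_ ?_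
  · intro h0
    have := congrArg (R.emb 1) h0
    rw [map_natCast, map_zero] at this
    exact hq.ne_zero (by exact_mod_cast this)
  · have hζ := (isPrimitiveRoot_stdAddChar (one_ne_zero (α := ZMod p))).isIntegral
      (Fact.out : p.Prime).pos
    have hint : ∀ Q : Polynomial ℤ, IsIntegral ℤ (Polynomial.aeval (χ (1 : ZMod p) : ℂ) Q) := by
      intro Q
      have := Polynomial.aeval_mem_adjoin_singleton ℤ (χ (1 : ZMod p) : ℂ) (p := Q)
      exact IsIntegral.of_mem_of_fg _ hζ.fg_adjoin_singleton _ this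
    refine IsIntegral.add ?_ (hint S)
    obtain ⟨b, -, hb⟩ := R.exists_coeff z
    rw [hb 1 one_ne_zero]
    refine IsIntegral.sum _ fun j _ => IsIntegral.mul ?_ ?_
    · exact isIntegral_algebraMap (R := ℤ) (x := b j)
    · by_cases hj : j = 0
      · rw [hj, mul_zero, AddChar.map_zero_eq_one]; exact isIntegral_one
      · rw [one_mul]
        exact (isPrimitiveRoot_stdAddChar hj).isIntegral (Fact.out : p.Prime).pos
  · rw [h2] at h1
    rw [map_natCast, mul_add]
    simp only [algebraMap_int_eq, eq_intCast, Int.cast_natCast] at h1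
    push_cast
    linear_combination h1

end RealCyclotomic

namespace RealCyclotomic

variable {p : ℕ} [Fact p.Prime] {O : Type*} [CommRing O] (R : RealCyclotomic p O)

lemma natCast_ne_zero (R : RealCyclotomic p O) {m : ℕ} (hm : m ≠ 0) : (m : O) ≠ 0 := by
  intro h
  have := R.intCast_injective (m := m) (n := 0) (by simpa using h)
  exact hm (by exact_mod_cast this)

/-! ### The unit `2 + gen` and its square root -/

lemma isUnit_two_add_gen (hp : p ≠ 2) : IsUnit (2 + R.gen) := by
  have hpp := (Fact.out : p.Prime)
  have h1 := one_ne_zero (α := ZMod p)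
  obtain ⟨h, hh⟩ := hpp.odd_of_ne_two hp
  have hγ0 : 2 + R.gen ≠ 0 := by
    intro h0
    have := R.emb_two_add_gen h1
    rw [h0, map_zero, eq_comm, Complex.normSq_eq_zero] at this
    have h2 : χ (1 : ZMod p) ^ 2 = 1 := by
      rw [eq_neg_of_add_eq_zero_right this]; norm_num
    have := (isPrimitiveRoot_stdAddChar h1).dvd_of_pow_eq_one _ h2
    exact hp ((Nat.prime_dvd_prime_iff_eq hpp Nat.prime_two).1 this)
  have hroot : ∀ s : ZMod p, s ≠ 0 → ∃ w : ℂ, IsIntegral ℤ w ∧ (1 + χ s) * w = 1 := by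
    intro s hs
    have hprim := isPrimitiveRoot_stdAddChar hs
    refine ⟨∑ i ∈ range (h + 1), (χ s ^ 2) ^ i, IsIntegral.sum _ fun i _ =>
      ((hprim.isIntegral hpp.pos).pow 2).pow i, ?_⟩
    have hne : (1 - χ s : ℂ) ≠ 0 := sub_ne_zero.2 (hprim.ne_one hpp.one_lt).symm
    apply mul_left_cancel₀ hne
    have hg := mul_neg_geom_sum (χ s ^ 2 : ℂ) (h + 1)
    have hpow : (χ s ^ 2 : ℂ) ^ (h + 1) = χ s := by
      rw [← pow_mul, show 2 * (h + 1) = p + 1 by omega, pow_succ, hprim.pow_eq_one, one_mul]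
    rw [hpow] at hg
    linear_combination hg
  obtain ⟨w, hw, hw1⟩ := hroot 1 h1
  obtain ⟨w', hw', hw1'⟩ := hroot (-1) (neg_ne_zero.2 h1)
  refine isUnit_of_dvd_one (R.dvd_of_isIntegral 1 h1 1 (2 + R.gen) hγ0 (w * w') (hw.mul hw') ?_)
  rw [map_one, R.emb_two_add_gen h1, ← Complex.mul_conj, map_add, map_one (starRingEnd ℂ),
    ← AddChar.map_neg_eq_conj]
  push_cast
  linear_combination (-(1 + χ (-1 : ZMod p)) * w') * hw1 - hw1'

/-- A square root of `2 + gen`. -/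
def rootUnit : O := R.E ((p + 1) / 2)

lemma rootUnit_sq (hp : p ≠ 2) : R.rootUnit ^ 2 = 2 + R.gen := by
  obtain ⟨h, hh⟩ := (Fact.out : p.Prime).odd_of_ne_two hp
  have h1 := R.E_mul_E ((p + 1) / 2) 0
  rw [add_zero, add_zero, show 2 * ((p + 1) / 2) = p + 1 by omega,
    R.E_congr (m := p + 1) (n := 1) (by left; simp)] at h1
  rw [rootUnit, sq, h1, E, E, add_comm]

lemma isUnit_rootUnit (hp : p ≠ 2) : IsUnit R.rootUnit := by
  have := R.isUnit_two_add_gen hp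
  rw [← R.rootUnit_sq hp] at this
  exact (isUnit_pow_iff two_ne_zero).1 this

/-! ### Congruences -/

lemma sum_E_val : ∑ j : ZMod p, R.E j.val = 0 := by
  refine R.ext_emb_complex fun t ht => ?_
  rw [map_sum, Complex.ofReal_sum, map_zero]
  simp only [R.emb_E ht, ZMod.natCast_zmod_val]
  rw [Finset.sum_add_distrib]
  have h1 := AddChar.sum_mulShift t (ZMod.isPrimitive_stdAddChar p)
  have h2 := AddChar.sum_mulShift (-t) (ZMod.isPrimitive_stdAddChar p)
  simp only [ht, neg_eq_zero, if_false, mul_comm _ t, mul_comm _ (-t), neg_mul] at h1 h2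
  rw [h1, h2]
  simp

lemma exists_two_mul_eq_sum (x : O) :
    ∃ a : ZMod p → ℤ, (∀ j, a (-j) = a j) ∧ (∀ t, t ≠ 0 → (R.emb t x : ℂ) = intFourier a t) ∧
      2 * x = ∑ j, (a j : O) * R.E j.val := by
  obtain ⟨a, ha, hx⟩ := R.exists_coeff x
  refine ⟨a, ha, hx, R.ext_emb_complex fun t ht => ?_⟩
  rw [map_sum, Complex.ofReal_sum, map_mul, map_ofNat, Complex.ofReal_mul, hx t ht]
  have h1 : ∀ j : ZMod p, ((R.emb t ((a j : O) * R.E j.val) : ℝ) : ℂ)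
      = a j * χ (t * j) + a j * χ (t * -j) := by
    intro j
    rw [map_mul, Complex.ofReal_mul, R.emb_E ht, ZMod.natCast_zmod_val, map_intCast, mul_neg]
    push_cast
    ring
  have h2 : ∑ j, (a j : ℂ) * χ (t * -j) = intFourier a t := by
    rw [intFourier]
    refine Fintype.sum_equiv (Equiv.neg _) _ _ fun j => ?_
    simp [ha]
  simp only [h1, Finset.sum_add_distrib, h2]
  rw [← intFourier]
  push_cast
  ring

lemma exists_int_dvd_E_sub {δ : O} {r : ℤ} (h : δ ∣ R.gen - r) (n : ℕ) :
    ∃ m : ℤ, δ ∣ R.E n - m := by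
  induction n using Nat.twoStepInduction with
  | zero => exact ⟨2, by simp [E]⟩
  | one => exact ⟨r, h⟩
  | more n h1 h2 =>
    obtain ⟨a, ha⟩ := h1
    obtain ⟨b, hb⟩ := h2
    obtain ⟨c, hc⟩ := h
    obtain ⟨u, hu⟩ := ha
    obtain ⟨v, hv⟩ := hb
    refine ⟨r * b - a, c * R.E (n + 1) + r * v - u, ?_⟩
    rw [E]
    push_cast
    linear_combination R.E (n + 1) * hc + r * hv - hu

/-- Modulo an element dividing `gen - r` and an odd number, everything is an integer. -/
lemma exists_int_dvd_sub {δ : O} {r : ℤ} (h : δ ∣ R.gen - r) {q : ℕ} (hq : Odd q)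
    (hδq : δ ∣ (q : O)) (x : O) : ∃ m : ℤ, δ ∣ x - m := by
  obtain ⟨a, -, -, hx⟩ := R.exists_two_mul_eq_sum x
  choose e he using R.exists_int_dvd_E_sub h
  obtain ⟨k, hk⟩ := hq
  refine ⟨(k + 1) * ∑ j, a j * e j.val, ?_⟩
  have h1 : δ ∣ 2 * x - ((∑ j, a j * e j.val : ℤ) : O) := by
    rw [hx]
    push_cast
    rw [← Finset.sum_sub_distrib]
    refine Finset.dvd_sum fun j _ => ?_
    rw [← mul_sub]
    exact (he _).mul_left _
  have h2 : x - (((k + 1) * ∑ j, a j * e j.val : ℤ) : O)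
      = (k + 1) * (2 * x - ((∑ j, a j * e j.val : ℤ) : O)) - q * x := by
    rw [hk]; push_cast; ring
  rw [h2]
  exact dvd_sub (h1.mul_left _) (hδq.mul_right _)

lemma dvd_of_dvd_intCast {δ : O} (hδ : ¬ IsUnit δ) {q : ℕ} (hq : q.Prime) (hδq : δ ∣ (q : O))
    {m : ℤ} (h : δ ∣ (m : O)) : (q : ℤ) ∣ m := by
  by_contra hcon
  have hcop := (Nat.prime_iff_prime_int.1 hq).coprime_iff_not_dvd.2 hcon
  obtain ⟨u, v, huv⟩ := hcop
  refine hδ (isUnit_of_dvd_one ?_)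
  have : (1 : O) = u * q + v * m := by exact_mod_cast congrArg (Int.cast (R := O)) huv.symm
  rw [this]
  exact dvd_add (hδq.mul_left _) (h.mul_left _)

lemma prime_of_dvd_gen_sub {δ : O} {r : ℤ} (h : δ ∣ R.gen - r) {q : ℕ} (hq : q.Prime)
    (hq2 : q ≠ 2) (hδq : δ ∣ (q : O)) (hδ : ¬ IsUnit δ) : Prime δ := by
  refine ⟨?_, hδ, fun x y hxy => ?_⟩
  · rintro rfl
    exact R.natCast_ne_zero hq.ne_zero (zero_dvd_iff.1 hδq)
  · obtain ⟨m, hm⟩ := R.exists_int_dvd_sub h (hq.odd_of_ne_two hq2) hδq x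
    obtain ⟨n, hn⟩ := R.exists_int_dvd_sub h (hq.odd_of_ne_two hq2) hδq y
    have h1 : δ ∣ ((m * n : ℤ) : O) := by
      have : ((m * n : ℤ) : O) = x * y - (x - m) * y - m * (y - n) := by push_cast; ring
      rw [this]
      exact dvd_sub (dvd_sub hxy (hm.mul_right _)) (hn.mul_left _)
    have h2 := dvd_of_dvd_intCast hδ hq hδq h1
    have h3 : ∀ k : ℤ, (q : ℤ) ∣ k → δ ∣ (k : O) := by
      rintro _ ⟨l, rfl⟩
      push_cast
      exact hδq.mul_right _
    rcases (Nat.prime_iff_prime_int.1 hq).dvd_or_dvd h2 with h4 | h4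
    · left; simpa using dvd_add hm (h3 _ h4)
    · right; simpa using dvd_add hn (h3 _ h4)

lemma unif_dvd_natCast (hp : p ≠ 2) : R.unif ∣ (p : O) := by
  have hE : ∀ n, R.unif ∣ R.E n - 2 := by
    intro n
    induction n using Nat.twoStepInduction with
    | zero => simp [E]
    | one => exact ⟨-1, by simp [E, unif]⟩
    | more n h1 h2 =>
      obtain ⟨a, ha⟩ := h1
      obtain ⟨b, hb⟩ := h2
      refine ⟨2 * b - a - R.E (n + 1), ?_⟩
      rw [E, unif] at *
      linear_combination 2 * hb - ha
  have h1 : R.unif ∣ ∑ j : ZMod p, (R.E j.val - 2) := Finset.dvd_sum fun j _ => hE _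
  rw [Finset.sum_sub_distrib, R.sum_E_val, zero_sub, dvd_neg, Finset.sum_const,
    Finset.card_univ, ZMod.card, nsmul_eq_mul] at h1
  have h2 : R.unif ∣ (p : O) * (2 + R.gen) := by
    have : (p : O) * (2 + R.gen) = p * 2 * 2 - R.unif * p := by rw [unif]; ring
    rw [this]
    exact dvd_sub (h1.mul_right _) (dvd_mul_right _ _)
  exact (R.isUnit_two_add_gen hp).dvd_mul_right.1 h2

lemma unif_prime (hp : p ≠ 2) : Prime R.unif :=
  R.prime_of_dvd_gen_sub (r := 2) ⟨-1, by rw [unif]; push_cast; ring⟩ Fact.out hp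
    (R.unif_dvd_natCast hp) R.unif_not_isUnit

lemma dvd_of_unif_dvd_intCast (hp : p ≠ 2) {m : ℤ} (h : R.unif ∣ (m : O)) : (p : ℤ) ∣ m :=
  dvd_of_dvd_intCast R.unif_not_isUnit Fact.out (R.unif_dvd_natCast hp) h

/-! ### Small squares -/

variable [IsDomain O]

lemma sq_ne_natCast (R : RealCyclotomic p O) {q : ℕ} (hq : q.Prime) (hqp : q ≠ p) (x : O) :
    x ^ 2 ≠ q := by
  intro h
  obtain ⟨k, hk⟩ : ∃ k, q = 2 + k := ⟨q - 2, by have := hq.two_le; omega⟩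
  have h1 : (q : O) ∣ x ^ q := by
    nth_rw 2 [hk]
    rw [pow_add, h]
    exact dvd_mul_right _ _
  obtain ⟨y, rfl⟩ := R.natCast_dvd_of_dvd_pow hq hqp h1
  refine R.natCast_not_isUnit hq.two_le (IsUnit.of_mul_eq_one (y ^ 2) ?_)
  apply mul_left_cancel₀ (R.natCast_ne_zero hq.ne_zero)
  linear_combination h

/-- The squares bounded by `3` are `0` and `1`. -/
lemma eq_zero_or_sq_eq_one (hp : 5 < p) {x : O} (h : ∀ t, t ≠ 0 → R.emb t x ^ 2 ≤ 3) :
    x = 0 ∨ x ^ 2 = 1 := by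
  have hy : x ^ 2 * (x ^ 2 - 1) * (x ^ 2 - 2) * (x ^ 2 - 3) * ((x ^ 2) ^ 2 - 3 * x ^ 2 + 1) = 0 := by
    refine R.eq_zero_of_abs_emb_lt_one fun t ht => ?_
    have h1 := h t ht
    have h0 := sq_nonneg (R.emb t x)
    simp only [map_mul, map_sub, map_add, map_pow, map_one, map_ofNat]
    set s := R.emb t x ^ 2
    obtain ⟨v, hv⟩ : ∃ v, v = s ^ 2 - 3 * s + 1 := ⟨_, rfl⟩
    have hv1 : v ≤ 1 := by nlinarith
    have hv2 : -5 / 4 ≤ v := by nlinarith [sq_nonneg (2 * s - 3)]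
    have : s * (s - 1) * (s - 2) * (s - 3) * (s ^ 2 - 3 * s + 1) = v * (v ^ 2 - 1) := by
      rw [hv]; ring
    rw [this, abs_lt]
    constructor <;> nlinarith [sq_nonneg (v - 1), sq_nonneg (v + 1), sq_nonneg v,
      mul_nonneg (sub_nonneg.2 hv1) (sub_nonneg.2 hv2)]
  rcases mul_eq_zero.1 hy with hy | hy
  · rcases mul_eq_zero.1 hy with hy | hy
    · rcases mul_eq_zero.1 hy with hy | hy
      · rcases mul_eq_zero.1 hy with hy | hy
        · exact Or.inl (pow_eq_zero_iff two_ne_zero |>.1 hy)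
        · exact Or.inr (sub_eq_zero.1 hy)
      · exact absurd (sub_eq_zero.1 hy)
          (by simpa using R.sq_ne_natCast Nat.prime_two (by omega) x)
    · exact absurd (sub_eq_zero.1 hy)
        (by simpa using R.sq_ne_natCast Nat.prime_three (by omega) x)
  · refine absurd ?_ (R.sq_ne_natCast Nat.prime_five (by omega) (2 * x ^ 2 - 3))
    push_cast
    linear_combination 4 * hy

lemma eq_zero_of_sq_le_unif (hp : 5 < p) {x : O}
    (h : ∀ t, t ≠ 0 → R.emb t x ^ 2 ≤ R.emb t R.unif) : x = 0 := by
  have hy : x ^ 2 * (R.unif - x ^ 2) = 0 := by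
    refine R.eq_zero_of_abs_emb_le (k := 2) (C := 4) (by norm_num) (fun t ht => ?_) ?_
    · have h1 := h t ht
      have h0 := sq_nonneg (R.emb t x)
      rw [map_mul, map_sub, map_pow, abs_of_nonneg (mul_nonneg h0 (sub_nonneg.2 h1))]
      nlinarith [sq_nonneg (2 * R.emb t x ^ 2 - R.emb t R.unif)]
    · have h1 : ∀ n : ℕ, (n + 7) ^ 4 < 4 ^ (n + 6) := by
        intro n
        induction n with
        | zero => norm_num
        | succ n ih =>
          have : (n + 1 + 7) ^ 4 ≤ 4 * (n + 7) ^ 4 := by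
            ring_nf
            nlinarith [sq_nonneg n, Nat.zero_le (n^3), Nat.zero_le (n^4), Nat.zero_le (n^2)]
          calc _ ≤ _ := this
            _ < 4 * 4 ^ (n + 6) := by omega
            _ = _ := by ring
      have hp6 : p ≠ 6 := by
        rintro rfl
        exact absurd (Fact.out : Nat.Prime 6) (by norm_num)
      obtain ⟨n, hn⟩ : ∃ n, p = n + 7 := ⟨p - 7, by omega⟩
      have h2 := h1 n
      rw [show n + 6 = p - 1 by omega, ← hn] at h2
      exact_mod_cast h2
  have hprime := R.unif_prime (by omega)
  rcases mul_eq_zero.1 hy with hy | hy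
  · exact pow_eq_zero_iff two_ne_zero |>.1 hy
  · exfalso
    have h1 : R.unif = x ^ 2 := sub_eq_zero.1 hy
    have h2 : R.unif ∣ x := hprime.dvd_of_dvd_pow (n := 2) (by rw [← h1])
    obtain ⟨z, hz⟩ := h2
    refine hprime.not_isUnit (IsUnit.of_mul_eq_one (z ^ 2) (mul_left_cancel₀ hprime.ne_zero ?_))
    nth_rw 3 [h1]
    rw [hz]; ring

end RealCyclotomic

namespace RealCyclotomic

variable {p : ℕ} [Fact p.Prime] {O : Type*} [CommRing O] (R : RealCyclotomic p O)

/-! ### Elements whose square is below twice `unif` -/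

lemma exists_coeff_zero_eq_zero (x : O) :
    ∃ a : ZMod p → ℤ, (∀ j, a (-j) = a j) ∧ a 0 = 0 ∧
      (∀ t, t ≠ 0 → (R.emb t x : ℂ) = intFourier a t) ∧
      2 * x = ∑ j, (a j : O) * R.E j.val := by
  obtain ⟨a, ha, h1, h2⟩ := R.exists_two_mul_eq_sum x
  refine ⟨fun j => a j - a 0, fun j => by simp [ha], by simp, fun t ht => ?_, ?_⟩
  · rw [h1 t ht]
    have h3 := AddChar.sum_mulShift t (ZMod.isPrimitive_stdAddChar p)
    simp only [ht, if_false, mul_comm _ t, Nat.cast_zero] at h3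
    simp only [intFourier, Int.cast_sub, sub_mul, Finset.sum_sub_distrib, ← Finset.mul_sum]
    rw [h3, mul_zero, sub_zero]
  · simp only [Int.cast_sub, sub_mul, Finset.sum_sub_distrib, ← Finset.mul_sum]
    rw [R.sum_E_val, mul_zero, sub_zero, h2]

lemma intConv_single {p : ℕ} [NeZero p] (i : ZMod p) (a : ZMod p → ℤ) (j : ZMod p) :
    intConv (Pi.single i 1) a j = a (j - i) := by
  rw [intConv, Finset.sum_eq_single i]
  · simp
  · intro b _ hb
    simp [Pi.single_eq_of_ne hb]
  · simp

lemma intConv_sub {p : ℕ} [NeZero p] (a b c : ZMod p → ℤ) (j : ZMod p) :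
    intConv (a - b) c j = intConv a c j - intConv b c j := by
  simp [intConv, sub_mul]

lemma intFourier_single {p : ℕ} [NeZero p] (i t : ZMod p) :
    intFourier (Pi.single i 1) t = χ (t * i) := by
  rw [intFourier, Finset.sum_eq_single i]
  · simp
  · intro b _ hb
    simp [Pi.single_eq_of_ne hb]
  · simp

lemma exists_coeff_of_sq_lt_two_mul_unif {b : O}
    (h : ∀ t, t ≠ 0 → R.emb t b ^ 2 < 2 * R.emb t R.unif) :
    ∃ a : ZMod p → ℤ, (∀ j, a (-j) = a j) ∧ a 0 = 0 ∧ 2 * b = ∑ j, (a j : O) * R.E j.val ∧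
      ∀ m : ZMod p → ℤ, ∑ j, m j = 0 → m ≠ 0 →
        ∑ j, intConv m a j ^ 2 <
          2 * ∑ j, intConv m (Pi.single 0 1 - Pi.single 1 1) j ^ 2 := by
  obtain ⟨a, ha, ha0, h1, h2⟩ := R.exists_coeff_zero_eq_zero b
  refine ⟨a, ha, ha0, h2, fun m hm hm0 => ?_⟩
  rw [two_mul]
  refine sum_sq_intConv_lt hm hm0 fun t ht => ?_
  rw [intFourier_sub, intFourier_single, intFourier_single, mul_zero, mul_one,
    AddChar.map_zero_eq_one, ← R.emb_unif ht, ← h1 t ht, Complex.normSq_ofReal]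
  linarith [h t ht]

lemma two_mul_sq_le {p : ℕ} [NeZero p] {a : ZMod p → ℤ} (ha : ∀ j, a (-j) = a j) (ha0 : a 0 = 0)
    {j : ZMod p} (hj : j ≠ 0) :
    2 * a j ^ 2 ≤ ∑ i, intConv (Pi.single 0 1 - Pi.single j 1) a i ^ 2 := by
  simp only [intConv_sub, intConv_single, sub_zero]
  calc 2 * a j ^ 2 = ∑ i ∈ {0, j}, (a i - a (i - j)) ^ 2 := by
        rw [Finset.sum_pair hj.symm, zero_sub, ha, sub_self, ha0]; ring
    _ ≤ _ := Finset.sum_le_sum_of_subset_of_nonneg (Finset.subset_univ _)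
        fun _ _ _ => sq_nonneg _

lemma sum_sq_intConv_single_sub {p : ℕ} [Fact (1 < p)] [NeZero p] (j : ZMod p) :
    ∑ i, intConv (Pi.single 0 1 - Pi.single j 1) (Pi.single 0 1 - Pi.single 1 1) i ^ 2 =
      4 - 2 * ((Pi.single 0 1 - Pi.single 1 1 : ZMod p → ℤ) (-j) -
      (Pi.single 0 1 - Pi.single 1 1 : ZMod p → ℤ) (1 - j)) := by
  set c : ZMod p → ℤ := Pi.single 0 1 - Pi.single 1 1 with hc
  have h0 : c 0 = 1 := by simp [hc]
  have h1 : c 1 = -1 := by simp [hc]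
  have h2 (f : ZMod p → ℤ) : ∑ i, c i * f i = f 0 - f 1 := by
    simp [hc, sub_mul, Finset.sum_sub_distrib, Pi.single_apply]
  have h3 : ∑ i, c i * c i = 2 := by rw [h2, h0, h1]; rfl
  have h4 : ∑ i, c (i - j) * c (i - j) = 2 := by
    rw [← h3]
    exact Equiv.sum_comp (Equiv.subRight j) fun i => c i * c i
  have h5 := h2 fun i => c (i - j)
  rw [zero_sub] at h5
  have h6 (i : ZMod p) : (c i - c (i - j)) ^ 2 =
      c i * c i + c (i - j) * c (i - j) - 2 * (c i * c (i - j)) := by ring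
  simp only [intConv_sub, intConv_single, sub_zero, h6, Finset.sum_add_distrib,
    Finset.sum_sub_distrib, ← Finset.mul_sum, h5, h3, h4]
  norm_num

lemma coeff_mem_Icc_two {p : ℕ} [Fact (1 < p)] [NeZero p] {a : ZMod p → ℤ} (ha : ∀ j, a (-j) = a j)
    (ha0 : a 0 = 0)
    (h : ∀ m : ZMod p → ℤ, ∑ j, m j = 0 → m ≠ 0 → ∑ j, intConv m a j ^ 2 <
      2 * ∑ j, intConv m (Pi.single 0 1 - Pi.single 1 1) j ^ 2) {j : ZMod p} (hj : j ≠ 0) :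
    a j ∈ Finset.Icc (-2) 2 := by
  have h1 := two_mul_sq_le ha ha0 hj
  have h2 := h (Pi.single 0 1 - Pi.single j 1) (by simp) fun h0 => by
    have := congrFun h0 0
    simp [hj.symm] at this
  rw [sum_sq_intConv_single_sub j] at h2
  rw [Finset.mem_Icc]
  have h4 : -2 ≤ (Pi.single 0 1 - Pi.single 1 1 : ZMod p → ℤ) (-j) -
      (Pi.single 0 1 - Pi.single 1 1 : ZMod p → ℤ) (1 - j) := by
    simp only [Pi.sub_apply, Pi.single_apply, neg_eq_zero, hj, if_false]
    split_ifs <;> norm_num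
  constructor <;> nlinarith

lemma coeff_mem_Icc_one {p : ℕ} [Fact (1 < p)] [NeZero p] {a : ZMod p → ℤ} (ha : ∀ j, a (-j) = a j)
    (ha0 : a 0 = 0)
    (h : ∀ m : ZMod p → ℤ, ∑ j, m j = 0 → m ≠ 0 → ∑ j, intConv m a j ^ 2 <
      2 * ∑ j, intConv m (Pi.single 0 1 - Pi.single 1 1) j ^ 2) {j : ZMod p} (hj : j ≠ 0)
    (hj1 : j ≠ 1) (hj2 : j ≠ -1) : a j ∈ Finset.Icc (-1) 1 := by
  have h1 := two_mul_sq_le ha ha0 hj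
  have h2 := h (Pi.single 0 1 - Pi.single j 1) (by simp) fun h0 => by
    have := congrFun h0 0
    simp [hj.symm] at this
  rw [sum_sq_intConv_single_sub j] at h2
  rw [Finset.mem_Icc]
  have h3 : -j ≠ 1 := fun h => hj2 (by rw [← h, neg_neg])
  have h4 : (1 : ZMod p) - j ≠ 0 := fun h => hj1 (sub_eq_zero.1 h).symm
  have h5 : (Pi.single 0 1 - Pi.single 1 1 : ZMod p → ℤ) (-j) -
      (Pi.single 0 1 - Pi.single 1 1 : ZMod p → ℤ) (1 - j) = 0 := by
    simp [hj, h3, h4]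
  rw [h5] at h2
  constructor <;> nlinarith

set_option maxRecDepth 100000 in
set_option maxHeartbeats 4000000 in
lemma coeff_seven {a : ZMod 7 → ℤ} (ha : ∀ j, a (-j) = a j) (ha0 : a 0 = 0)
    (h : ∀ m : ZMod 7 → ℤ, ∑ j, m j = 0 → m ≠ 0 → ∑ j, intConv m a j ^ 2 <
      2 * ∑ j, intConv m (Pi.single 0 1 - Pi.single 1 1) j ^ 2) :
    ∃ e : ℤ, a 1 = e ∧ a 2 = e ∧ a 3 = e ∧ (e = 0 ∨ e = 1 ∨ e = -1) ∨
      a 1 = 0 ∧ a 2 = e ∧ a 3 = 0 ∧ (e = 1 ∨ e = -1) ∨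
      a 1 = e ∧ a 2 = 0 ∧ a 3 = e ∧ (e = 1 ∨ e = -1) := by
  have : Fact (1 < 7) := ⟨by norm_num⟩
  have H : ∀ m : Fin 7 → ℤ, ∑ j, m j = 0 → m ≠ 0 →
      ∑ j : Fin 7, (∑ k : Fin 7, m k * a (j - k)) ^ 2 <
      2 * ∑ j : Fin 7, (∑ k : Fin 7, m k *
        (![1, -1, 0, 0, 0, 0, 0] : Fin 7 → ℤ) (j - k)) ^ 2 := by
    have hd : (Pi.single 0 1 - Pi.single 1 1 : ZMod 7 → ℤ) =
      (![1, -1, 0, 0, 0, 0, 0] : Fin 7 → ℤ) := by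
      funext j
      fin_cases j <;> rfl
    rw [hd] at h
    exact h
  have hb1 := coeff_mem_Icc_two ha ha0 h (j := 1) (by decide)
  have hb2 := coeff_mem_Icc_two ha ha0 h (j := 2) (by decide)
  have hb3 := coeff_mem_Icc_two ha ha0 h (j := 3) (by decide)
  have haa : a = (![0, a 1, a 2, a 3, a 3, a 2, a 1] : Fin 7 → ℤ) := by
    funext j
    fin_cases j
    exacts [ha0, rfl, rfl, rfl, ha 3, ha 2, ha 1]
  generalize a 1 = a1, a 2 = a2, a 3 = a3 at haa hb1 hb2 hb3 ⊢
  rw [haa] at H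
  have h1 := H ![1, 1, 0, -1, -1, 0, 0] (by decide) (by decide)
  have h2 := H ![1, -1, 0, 0, 0, 0, 0] (by decide) (by decide)
  have h3 := H ![2, -2, 1, 0, 0, 1, -2] (by decide) (by decide)
  have h4 := H ![2, 0, -2, 1, 1, -2, 0] (by decide) (by decide)
  have h5 := H ![-4, -2, 1, 3, 3, 1, -2] (by decide) (by decide)
  simp [Fin.sum_univ_succ] at h1 h2 h3 h4 h5
  clear H haa ha ha0 h
  suffices h : (a1 = a2 ∧ a2 = a3 ∧ (a1 = 0 ∨ a1 = 1 ∨ a1 = -1)) ∨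
      (a1 = 0 ∧ a3 = 0 ∧ (a2 = 1 ∨ a2 = -1)) ∨ (a2 = 0 ∧ a1 = a3 ∧ (a1 = 1 ∨ a1 = -1)) by
    rcases h with ⟨rfl, rfl, h⟩ | ⟨rfl, rfl, h⟩ | ⟨rfl, rfl, h⟩
    · exact ⟨_, Or.inl ⟨rfl, rfl, rfl, h⟩⟩
    · exact ⟨_, Or.inr (Or.inl ⟨rfl, rfl, rfl, h⟩)⟩
    · exact ⟨_, Or.inr (Or.inr ⟨rfl, rfl, rfl, h⟩)⟩
  revert a1
  revert a2
  revert a3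
  decide +kernel

set_option maxRecDepth 100000 in
set_option maxHeartbeats 4000000 in
lemma coeff_eleven {a : ZMod 11 → ℤ} (ha : ∀ j, a (-j) = a j) (ha0 : a 0 = 0)
    (h : ∀ m : ZMod 11 → ℤ, ∑ j, m j = 0 → m ≠ 0 → ∑ j, intConv m a j ^ 2 <
      2 * ∑ j, intConv m (Pi.single 0 1 - Pi.single 1 1) j ^ 2) :
    a 1 = 0 ∧ a 2 = 0 ∧ a 3 = 0 ∧ a 4 = 0 ∧ a 5 = 0 := by
  have : Fact (1 < 11) := ⟨by norm_num⟩
  have H : ∀ m : Fin 11 → ℤ, ∑ j, m j = 0 → m ≠ 0 →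
      ∑ j : Fin 11, (∑ k : Fin 11, m k * a (j - k)) ^ 2 <
      2 * ∑ j : Fin 11, (∑ k : Fin 11, m k *
        (![1, -1, 0, 0, 0, 0, 0, 0, 0, 0, 0] : Fin 11 → ℤ) (j - k)) ^ 2 := by
    have hd : (Pi.single 0 1 - Pi.single 1 1 : ZMod 11 → ℤ) =
      (![1, -1, 0, 0, 0, 0, 0, 0, 0, 0, 0] : Fin 11 → ℤ) := by
      funext j
      fin_cases j <;> rfl
    rw [hd] at h
    exact h
  have hb1 := coeff_mem_Icc_two ha ha0 h (j := 1) (by decide)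
  have hb2 := coeff_mem_Icc_one ha ha0 h (j := 2) (by decide) (by decide) (by decide)
  have hb3 := coeff_mem_Icc_one ha ha0 h (j := 3) (by decide) (by decide) (by decide)
  have hb4 := coeff_mem_Icc_one ha ha0 h (j := 4) (by decide) (by decide) (by decide)
  have hb5 := coeff_mem_Icc_one ha ha0 h (j := 5) (by decide) (by decide) (by decide)
  have haa : a = (![0, a 1, a 2, a 3, a 4, a 5, a 5, a 4, a 3, a 2, a 1] : Fin 11 → ℤ) := by
    funext j
    fin_cases j
    exacts [ha0, rfl, rfl, rfl, rfl, rfl, ha 5, ha 4, ha 3, ha 2, ha 1]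
  generalize a 1 = a1, a 2 = a2, a 3 = a3, a 4 = a4, a 5 = a5 at haa hb1 hb2 hb3 hb4 hb5 ⊢
  rw [haa] at H
  have h1 := H ![1, 1, 1, 0, -1, -1, -1, 0, 0, 0, 0] (by decide) (by decide)
  have h2 := H ![1, 0, 0, 0, 0, -1, 0, 0, 0, 0, 0] (by decide) (by decide)
  have h3 := H ![1, 1, 1, 1, 0, -1, -1, -1, -1, 0, 0] (by decide) (by decide)
  have h4 := H ![1, 1, 0, 0, 0, -1, -1, 0, 0, 0, 0] (by decide) (by decide)
  have h5 := H ![1, 0, 0, -1, 0, 0, 0, 0, 0, 0, 0] (by decide) (by decide)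
  have h6 := H ![1, 0, 0, 0, -1, 0, 0, 0, 0, 0, 0] (by decide) (by decide)
  have h7 := H ![1, 1, 0, -1, -1, 0, 0, 0, 0, 0, 0] (by decide) (by decide)
  have h8 := H ![2, -2, 1, 0, 0, 0, 0, 0, 0, 1, -2] (by decide) (by decide)
  have h9 := H ![2, -1, 0, 1, -1, 0, 0, -1, 1, 0, -1] (by decide) (by decide)
  have h10 := H ![2, 0, -2, 0, 1, 0, 0, 1, 0, -2, 0] (by decide) (by decide)
  have h11 := H ![-2, -1, 1, 1, 1, -1, -1, 1, 1, 1, -1] (by decide) (by decide)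
  have h12 := H ![-2, -2, -2, 0, 2, 3, 3, 2, 0, -2, -2] (by decide) (by decide)
  simp [Fin.sum_univ_succ] at h1 h2 h3 h4 h5 h6 h7 h8 h9 h10 h11 h12
  clear H haa ha ha0 h
  revert a1
  revert a2
  revert a3
  revert a4
  revert a5
  decide +kernel

set_option maxRecDepth 100000 in
set_option maxHeartbeats 4000000 in
lemma coeff_thirteen {a : ZMod 13 → ℤ} (ha : ∀ j, a (-j) = a j) (ha0 : a 0 = 0)
    (h : ∀ m : ZMod 13 → ℤ, ∑ j, m j = 0 → m ≠ 0 → ∑ j, intConv m a j ^ 2 <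
      2 * ∑ j, intConv m (Pi.single 0 1 - Pi.single 1 1) j ^ 2) :
    a 1 = 0 ∧ a 2 = 0 ∧ a 3 = 0 ∧ a 4 = 0 ∧ a 5 = 0 ∧ a 6 = 0 := by
  have : Fact (1 < 13) := ⟨by norm_num⟩
  have H : ∀ m : Fin 13 → ℤ, ∑ j, m j = 0 → m ≠ 0 →
      ∑ j : Fin 13, (∑ k : Fin 13, m k * a (j - k)) ^ 2 <
      2 * ∑ j : Fin 13, (∑ k : Fin 13, m k *
        (![1, -1, 0, 0, 0, 0, 0, 0, 0, 0, 0, 0, 0] : Fin 13 → ℤ) (j - k)) ^ 2 := by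
    have hd : (Pi.single 0 1 - Pi.single 1 1 : ZMod 13 → ℤ) =
      (![1, -1, 0, 0, 0, 0, 0, 0, 0, 0, 0, 0, 0] : Fin 13 → ℤ) := by
      funext j
      fin_cases j <;> rfl
    rw [hd] at h
    exact h
  have hb1 := coeff_mem_Icc_two ha ha0 h (j := 1) (by decide)
  have hb2 := coeff_mem_Icc_one ha ha0 h (j := 2) (by decide) (by decide) (by decide)
  have hb3 := coeff_mem_Icc_one ha ha0 h (j := 3) (by decide) (by decide) (by decide)
  have hb4 := coeff_mem_Icc_one ha ha0 h (j := 4) (by decide) (by decide) (by decide)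
  have hb5 := coeff_mem_Icc_one ha ha0 h (j := 5) (by decide) (by decide) (by decide)
  have hb6 := coeff_mem_Icc_one ha ha0 h (j := 6) (by decide) (by decide) (by decide)
  have haa : a = (![0, a 1, a 2, a 3, a 4, a 5, a 6, a 6, a 5, a 4, a 3, a 2, a 1] : Fin 13 → ℤ) := by
    funext j
    fin_cases j
    exacts [ha0, rfl, rfl, rfl, rfl, rfl, rfl, ha 6, ha 5, ha 4, ha 3, ha 2, ha 1]
  generalize a 1 = a1, a 2 = a2, a 3 = a3, a 4 = a4, a 5 = a5, a 6 = a6 at haa hb1 hb2 hb3 hb4 hb5 hb6 ⊢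
  rw [haa] at H
  have h1 := H ![1, 1, 1, 0, 0, -1, -1, -1, 0, 0, 0, 0, 0] (by decide) (by decide)
  have h2 := H ![1, 1, 0, 0, 0, 0, -1, -1, 0, 0, 0, 0, 0] (by decide) (by decide)
  have h3 := H ![1, 1, 1, 1, 0, 0, -1, -1, -1, -1, 0, 0, 0] (by decide) (by decide)
  have h4 := H ![1, 0, 0, 0, 0, -1, 0, 0, 0, 0, 0, 0, 0] (by decide) (by decide)
  have h5 := H ![1, 1, 0, -1, -1, 0, 0, 0, 0, 0, 0, 0, 0] (by decide) (by decide)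
  simp [Fin.sum_univ_succ] at h1 h2 h3 h4 h5
  clear H haa ha ha0 h
  revert a1
  revert a2
  revert a3
  revert a4
  revert a5
  revert a6
  decide +kernel

end RealCyclotomic

namespace RealCyclotomic

variable {p : ℕ} [Fact p.Prime] {O : Type*} [CommRing O] (R : RealCyclotomic p O)

lemma pow_lt_pow_sub_one {n : ℕ} (hn : 17 ≤ n) : (n : ℝ) ^ (2 * 20) < 3125 ^ (n - 1) := by
  induction n, hn using Nat.le_induction with
  | base => norm_num
  | succ n hn ih =>
    have h1 : ((n + 1 : ℕ) : ℝ) ≤ 18 / 17 * n := by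
      have : (17 : ℝ) ≤ n := by exact_mod_cast hn
      push_cast
      linarith
    obtain ⟨m, rfl⟩ : ∃ m, n = m + 1 := ⟨n - 1, by omega⟩
    simp only [Nat.add_sub_cancel] at ih ⊢
    calc (((m + 1 + 1 : ℕ) : ℝ)) ^ (2 * 20) ≤ (18 / 17 * ((m + 1 : ℕ) : ℝ)) ^ (2 * 20) := by
          gcongr
      _ = (18 / 17) ^ (2 * 20) * ((m + 1 : ℕ) : ℝ) ^ (2 * 20) := mul_pow _ _ _
      _ ≤ 3125 * ((m + 1 : ℕ) : ℝ) ^ (2 * 20) := by gcongr; norm_num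
      _ < 3125 * 3125 ^ m := by gcongr
      _ = 3125 ^ (m + 1) := by ring

lemma not_unif_dvd_natCast (hp : p ≠ 2) {m : ℕ} (hm : ¬ p ∣ m) : ¬ R.unif ∣ (m : O) := fun h => by
  have := R.dvd_of_unif_dvd_intCast hp (m := m) (by exact_mod_cast h)
  exact hm (by exact_mod_cast this)

lemma not_two_dvd_unif (hp : p ≠ 2) : ¬ 2 ∣ R.unif := fun h => by
  have h1 : (2 : O) ∣ 2 + R.gen := by
    have : 2 + R.gen = 2 * 2 - R.unif := by rw [unif]; ring
    rw [this]
    exact dvd_sub (dvd_mul_right _ _) h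
  exact R.natCast_not_isUnit le_rfl (isUnit_of_dvd_unit (by exact_mod_cast h1)
    (R.isUnit_two_add_gen hp))

lemma mul_one_sub_pow_four_le {s : ℝ} (hs : s ≤ 1) : s * (1 - s) ^ 4 ≤ 256 / 3125 := by
  have : 256 / 3125 - s * (1 - s) ^ 4 =
      (s - 1 / 5) ^ 2 * ((1 - s) ^ 3 + 3 / 5 * (1 - s) ^ 2 + 8 / 25 * (1 - s) + 16 / 125) := by ring
  have h1 : 0 ≤ 1 - s := by linarith
  have h2 : 0 ≤ (s - 1 / 5) ^ 2 *
      ((1 - s) ^ 3 + 3 / 5 * (1 - s) ^ 2 + 8 / 25 * (1 - s) + 16 / 125) := by positivity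
  linarith

variable [IsDomain O]

lemma sq_ne_unif (hp : p ≠ 2) (b : O) : b ^ 2 ≠ R.unif := fun h =>
  (R.unif_prime hp).irreducible.not_isSquare ⟨b, by rw [← h, sq]⟩

lemma sq_ne_two_mul_unif (hp : 5 < p) (b : O) : b ^ 2 ≠ 2 * R.unif := fun h => by
  have hp2 : p ≠ 2 := by omega
  have hπ := R.unif_prime hp2
  obtain ⟨c, rfl⟩ := hπ.dvd_of_dvd_pow (Dvd.intro_left _ h.symm)
  have h1 : R.unif * c ^ 2 = 2 := mul_left_cancel₀ hπ.ne_zero (by linear_combination h)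
  refine R.not_unif_dvd_natCast hp2 (m := 2) (fun h => ?_) ⟨c ^ 2, by rw [h1]; rfl⟩
  have := Nat.le_of_dvd two_pos h
  omega

lemma eq_zero_of_sq_lt_two_mul_unif_of_le (hp : 17 ≤ p) {b : O}
    (h : ∀ t, t ≠ 0 → R.emb t b ^ 2 < 2 * R.emb t R.unif) : b = 0 := by
  have hp2 : p ≠ 2 := by omega
  set y := (b ^ 2 * (2 * R.unif - b ^ 2)) ^ 2 * (b ^ 2 - R.unif) ^ 4 *
    (2 * (b ^ 2 - R.unif) ^ 2 - R.unif ^ 2) with hy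
  have h0 : y ^ 2 = 0 := by
    refine R.eq_zero_of_abs_emb_le (k := 20) (C := 3125) (by norm_num) (fun t ht => ?_)
      (pow_lt_pow_sub_one hp)
    have hπ := R.emb_unif_pos ht
    have hb := h t ht
    rw [abs_of_nonneg (by rw [map_pow]; positivity)]
    simp only [hy, map_mul, map_pow, map_sub, map_ofNat]
    generalize R.emb t R.unif = π at *
    generalize R.emb t b = β at *
    obtain ⟨r, hr⟩ : ∃ r, β ^ 2 = (1 + r) * π := ⟨β ^ 2 / π - 1, by field_simp; ring⟩
    have h1 : r < 1 := by nlinarith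
    have h2 : -1 ≤ r := by
      have : 0 ≤ (1 + r) * π := hr ▸ sq_nonneg β
      nlinarith [nonneg_of_mul_nonneg_left this hπ]
    have h3 : (2 * r ^ 2 - 1) ^ 2 ≤ 1 := by
      have : r ^ 2 ≤ 1 := by nlinarith
      nlinarith [sq_nonneg r]
    have h4 := mul_one_sub_pow_four_le h3
    rw [hr]
    have h5 : ((((1 + r) * π * (2 * π - (1 + r) * π)) ^ 2 * ((1 + r) * π - π) ^ 4 *
        (2 * ((1 + r) * π - π) ^ 2 - π ^ 2)) ^ 2) =
        π ^ 20 * ((2 * r ^ 2 - 1) ^ 2 * (1 - (2 * r ^ 2 - 1) ^ 2) ^ 4) / 256 := by ring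
    rw [h5]
    have : 0 < π ^ 20 := by positivity
    nlinarith
  rw [sq_eq_zero_iff] at h0
  rcases mul_eq_zero.1 h0 with h0 | h0
  · rcases mul_eq_zero.1 h0 with h0 | h0
    · rcases mul_eq_zero.1 (pow_eq_zero_iff (two_ne_zero)|>.1 h0) with h0 | h0
      · exact pow_eq_zero_iff two_ne_zero |>.1 h0
      · exact (R.sq_ne_two_mul_unif (by omega) b (sub_eq_zero.1 h0).symm).elim
    · exact (R.sq_ne_unif hp2 b (sub_eq_zero.1 (pow_eq_zero_iff four_ne_zero |>.1 h0))).elim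
  · refine (R.not_two_dvd_unif hp2 ?_).elim
    have := R.natCast_dvd_of_dvd_pow Nat.prime_two (by omega : 2 ≠ p) (x := R.unif)
      (by rw [Nat.cast_ofNat, ← sub_eq_zero.1 h0]; exact dvd_mul_right _ _)
    exact_mod_cast this

lemma eq_zero_of_sq_lt_two_mul_unif (hp : 7 < p) {b : O}
    (h : ∀ t, t ≠ 0 → R.emb t b ^ 2 < 2 * R.emb t R.unif) : b = 0 := by
  have h2 : (2 : O) ≠ 0 := by exact_mod_cast R.natCast_ne_zero two_ne_zero
  obtain hp | rfl | rfl : 17 ≤ p ∨ p = 11 ∨ p = 13 := by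
    have hprime : p.Prime := Fact.out
    by_contra!
    have : p < 17 := this.1
    interval_cases p <;> revert hprime <;> simp_all <;> decide
  · exact R.eq_zero_of_sq_lt_two_mul_unif_of_le hp h
  · obtain ⟨a, ha, ha0, hb, h⟩ := R.exists_coeff_of_sq_lt_two_mul_unif h
    obtain ⟨h1, h2', h3, h4, h5⟩ := coeff_eleven ha ha0 h
    have h0 : ∀ j, a j = 0 := by
      intro j
      fin_cases j
      exacts [ha0, h1, h2', h3, h4, h5, (ha 5).trans h5, (ha 4).trans h4, (ha 3).trans h3,
        (ha 2).trans h2', (ha 1).trans h1]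
    simpa [h0, h2] using hb
  · obtain ⟨a, ha, ha0, hb, h⟩ := R.exists_coeff_of_sq_lt_two_mul_unif h
    obtain ⟨h1, h2', h3, h4, h5, h6⟩ := coeff_thirteen ha ha0 h
    have h0 : ∀ j, a j = 0 := by
      intro j
      fin_cases j
      exacts [ha0, h1, h2', h3, h4, h5, h6, (ha 6).trans h6, (ha 5).trans h5, (ha 4).trans h4,
        (ha 3).trans h3, (ha 2).trans h2', (ha 1).trans h1]
    simpa [h0, h2] using hb

end RealCyclotomic

namespace RealCyclotomic

section

variable {p : ℕ} [Fact p.Prime] {O : Type*} [CommRing O] (R : RealCyclotomic p O)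

lemma reindex_E {k : ℕ} (hk : (k : ZMod p) ≠ 0) (n : ℕ) : (R.reindex k hk).E n = R.E (k * n) := by
  refine (R.reindex k hk).ext_emb_complex fun t ht => ?_
  rw [(R.reindex k hk).emb_E ht]
  change _ = ((R.emb (t * (k : ZMod p)⁻¹) (R.E (k * n)) : ℝ) : ℂ)
  rw [R.emb_E (mul_ne_zero ht (inv_ne_zero hk))]
  have : t * (k : ZMod p)⁻¹ * ((k * n : ℕ) : ZMod p) = t * n := by
    push_cast
    field_simp
  rw [this]

lemma natCast_zmod_ne_zero {k : ℕ} (h : ¬ p ∣ k) : (k : ZMod p) ≠ 0 := by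
  rwa [Ne, ZMod.natCast_eq_zero_iff]

lemma E_eq_of_mod_eq {m n : ℕ} (h : m % p = n % p) : R.E m = R.E n :=
  R.E_congr (Or.inl ((ZMod.natCast_eq_natCast_iff' _ _ _).2 h))

lemma E_eq_of_dvd_add {m n : ℕ} (h : p ∣ m + n) : R.E m = R.E n :=
  R.E_congr (Or.inr (eq_neg_of_add_eq_zero_left (by
    rw [← Nat.cast_add, ZMod.natCast_eq_zero_iff]
    exact h)))

lemma emb_E_eq_emb_gen {t : ZMod p} (ht : t ≠ 0) {k : ℕ} (hk : (k : ZMod p) ≠ 0) :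
    R.emb t (R.E k) = R.emb (t * k) R.gen := by
  have h : (R.emb t (R.E k) : ℂ) = R.emb (t * k) R.gen := by
    rw [R.emb_E ht, R.emb_gen _ (mul_ne_zero ht hk)]
  exact_mod_cast h

lemma prod_emb_E (F : ℝ → ℝ) {k : ℕ} (hk : (k : ZMod p) ≠ 0) :
    ∏ t with t ≠ 0, F (R.emb t (R.E k)) = ∏ t with t ≠ 0, F (R.emb t R.gen) := by
  refine Finset.prod_nbij' (· * (k : ZMod p)) (· * (k : ZMod p)⁻¹) ?_ ?_ ?_ ?_ ?_
  · intro t ht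
    simp_all
  · intro t ht
    simp_all
  · intro t _
    simp [hk]
  · intro t _
    simp [hk]
  · intro t ht
    rw [R.emb_E_eq_emb_gen (by simpa using ht) hk]

lemma E_two_eq : R.E 2 = R.gen ^ 2 - 2 := by
  simp only [E]
  ring

lemma E_three_eq : R.E 3 = R.gen ^ 3 - 3 * R.gen := by
  simp only [E]
  ring

end

section Seven

variable [Fact (Nat.Prime 7)] {O : Type*} [CommRing O] [IsDomain O] (R : RealCyclotomic 7 O)

lemma gen_pow_three : R.gen ^ 3 + R.gen ^ 2 - 2 * R.gen - 1 = 0 := by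
  have h := R.sum_E_val
  have h1 : ∑ j : ZMod 7, R.E j.val =
      R.E 0 + R.E 1 + R.E 2 + R.E 3 + R.E 4 + R.E 5 + R.E 6 :=
    Fin.sum_univ_seven (fun j : Fin 7 => R.E j.val)
  have h4 : R.E 4 = R.E 3 := R.E_eq_of_dvd_add (by decide)
  have h5 : R.E 5 = R.E 2 := R.E_eq_of_dvd_add (by decide)
  have h6 : R.E 6 = R.E 1 := R.E_eq_of_dvd_add (by decide)
  have h2 : (2 : O) ≠ 0 := by exact_mod_cast R.natCast_ne_zero two_ne_zero
  rw [h1, h4, h5, h6, E_two_eq, E_three_eq] at h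
  simp only [E] at h
  refine mul_left_cancel₀ h2 ?_
  linear_combination h

lemma three_sub_two_mul_gen_not_isUnit : ¬ IsUnit (3 - 2 * R.gen) := by
  intro h
  obtain ⟨u, hu⟩ := h.exists_right_inv
  have h1 := R.prod_abs_emb_of_mul_eq_one hu
  have h13 : (3 - 2 * R.gen) * (3 - 2 * R.E 2) * (3 - 2 * R.E 3) = 13 := by
    rw [E_two_eq, E_three_eq]
    linear_combination (-50 + 16 * R.gen + 20 * R.gen ^ 2 - 8 * R.gen ^ 3) * R.gen_pow_three
  have h2 := R.prod_emb_E (fun x => |3 - 2 * x|) (k := 2) (natCast_zmod_ne_zero (by decide))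
  have h3 := R.prod_emb_E (fun x => |3 - 2 * x|) (k := 3) (natCast_zmod_ne_zero (by decide))
  simp only [map_sub, map_mul, map_ofNat] at h1
  rw [h1] at h2 h3
  have h4 : ∏ t : ZMod 7 with t ≠ 0, |R.emb t 13| = 1 := by
    rw [← h13]
    simp only [map_sub, map_mul, map_ofNat, abs_mul, Finset.prod_mul_distrib, h1, h2, h3, mul_one]
  simp only [map_ofNat, Finset.prod_const, card_filter_ne_zero] at h4
  norm_num at h4

lemma mul_ne_sq_of_dvd {D : O} (hD : D ∣ 3 - 2 * R.gen) (hD' : 3 - 2 * R.gen ∣ D) (x y : O) :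
    D * (2 * (3 + R.E 3) - x ^ 2) ≠ y ^ 2 := by
  intro h
  set δ := 3 - 2 * R.gen with hδ
  have h13 : δ ∣ ((13 : ℕ) : O) := ⟨7 + 10 * R.gen + 4 * R.gen ^ 2, by
    push_cast
    linear_combination 8 * R.gen_pow_three⟩
  have h8 : δ ∣ R.gen - (8 : ℤ) := ⟨-4 - 5 * R.gen - 2 * R.gen ^ 2, by
    push_cast
    linear_combination -4 * R.gen_pow_three⟩
  have h7 : δ ∣ 2 * (3 + R.E 3) - 7 := ⟨-1 - 4 * R.gen - 2 * R.gen ^ 2, by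
    rw [E_three_eq]
    linear_combination -2 * R.gen_pow_three⟩
  have hp := R.prime_of_dvd_gen_sub h8 (by norm_num) (by norm_num) h13
    R.three_sub_two_mul_gen_not_isUnit
  obtain ⟨c, hc⟩ := hD
  obtain ⟨y', rfl⟩ := hp.dvd_of_dvd_pow (h ▸ hD'.mul_right _)
  have h1 : 2 * (3 + R.E 3) - x ^ 2 = δ * (c * y' ^ 2) := by
    refine mul_left_cancel₀ hp.ne_zero ?_
    linear_combination c * h + (2 * (3 + R.E 3) - x ^ 2) * hc
  obtain ⟨n, hn⟩ := R.exists_int_dvd_sub h8 (by decide) h13 x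
  have h2 : δ ∣ ((7 - n ^ 2 : ℤ) : O) := by
    have : ((7 - n ^ 2 : ℤ) : O) = δ * (c * y' ^ 2) - (2 * (3 + R.E 3) - 7) +
        (x - n) * (x + n) := by
      push_cast
      linear_combination h1
    rw [this]
    exact dvd_add (dvd_sub (dvd_mul_right _ _) h7) (hn.mul_right _)
  have h3 := dvd_of_dvd_intCast R.three_sub_two_mul_gen_not_isUnit (by norm_num) h13 h2
  have h4 := (ZMod.intCast_zmod_eq_zero_iff_dvd _ 13).2 h3
  push_cast at h4
  revert h4
  generalize (n : ZMod 13) = m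
  revert m
  decide

lemma exists_forall_mul_ne_sq_of_sq_lt {b : O} (hb : b ≠ 0)
    (h : ∀ t, t ≠ 0 → R.emb t b ^ 2 < 2 * R.emb t R.unif) :
    ∃ k : ℕ, (k : ZMod 7) ≠ 0 ∧
      ∀ x y : O, (2 * R.unif - b ^ 2) * (2 * (3 + R.E k) - x ^ 2) ≠ y ^ 2 := by
  obtain ⟨a, ha, ha0, h2b, h⟩ := R.exists_coeff_of_sq_lt_two_mul_unif h
  have h1 : ∑ j : ZMod 7, (a j : O) * R.E j.val =
      a 0 * R.E 0 + a 1 * R.E 1 + a 2 * R.E 2 + a 3 * R.E 3 + a 4 * R.E 4 + a 5 * R.E 5 +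
        a 6 * R.E 6 :=
    Fin.sum_univ_seven (fun j : Fin 7 => (a j : O) * R.E j.val)
  have h4 : R.E 4 = R.E 3 := R.E_eq_of_dvd_add (by decide)
  have h5 : R.E 5 = R.E 2 := R.E_eq_of_dvd_add (by decide)
  have h6 : R.E 6 = R.E 1 := R.E_eq_of_dvd_add (by decide)
  have ha4 : a 4 = a 3 := ha 3
  have ha5 : a 5 = a 2 := ha 2
  have ha6 : a 6 = a 1 := ha 1
  have h2 : (2 : O) ≠ 0 := by exact_mod_cast R.natCast_ne_zero two_ne_zero
  have hb' : b = a 1 * R.gen + a 2 * (R.gen ^ 2 - 2) + a 3 * (R.gen ^ 3 - 3 * R.gen) := by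
    rw [h1, h4, h5, h6, ha0, ha4, ha5, ha6, E_two_eq, E_three_eq] at h2b
    simp only [E] at h2b
    refine mul_left_cancel₀ h2 ?_
    push_cast at h2b
    linear_combination h2b
  have key := R.gen_pow_three
  have hsq : b ^ 2 = 1 ∨ b ^ 2 = (R.gen ^ 2 - 2) ^ 2 ∨ b ^ 2 = (R.gen ^ 2 - 1) ^ 2 := by
    obtain ⟨e, ⟨h1, h2, h3, he⟩ | ⟨h1, h2, h3, he⟩ | ⟨h1, h2, h3, he⟩⟩ := coeff_seven ha ha0 h <;>
      rw [h1, h2, h3] at hb'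
    · have hbe : b = -e := by linear_combination hb' + e * key
      rcases he with rfl | rfl | rfl
      · simp_all
      · left; simp [hbe]
      · left; simp [hbe]
    · have hbe : b = e * (R.gen ^ 2 - 2) := by rw [hb']; push_cast; ring
      right; left
      rcases he with rfl | rfl <;> rw [hbe] <;> push_cast <;> ring
    · have hbe : b = -e * (R.gen ^ 2 - 1) := by linear_combination hb' + e * key
      right; right
      rcases he with rfl | rfl <;> rw [hbe] <;> push_cast <;> ring
  rcases hsq with hsq | hsq | hsq
  · refine ⟨3, natCast_zmod_ne_zero (by decide), ?_⟩
    have : 2 * R.unif - b ^ 2 = 3 - 2 * R.gen := by rw [hsq, unif]; ring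
    rw [this]
    exact R.mul_ne_sq_of_dvd dvd_rfl dvd_rfl
  · refine ⟨2, natCast_zmod_ne_zero (by decide), ?_⟩
    have h3 : ((3 : ℕ) : ZMod 7) ≠ 0 := natCast_zmod_ne_zero (by decide)
    have hg : (R.reindex 3 h3).gen = R.gen ^ 3 - 3 * R.gen := R.E_three_eq
    have hE : R.E 2 = (R.reindex 3 h3).E 3 := by
      rw [reindex_E]
      exact R.E_eq_of_mod_eq (by decide)
    rw [hE]
    apply mul_ne_sq_of_dvd <;> rw [hg, hsq, unif]
    · exact ⟨1 + 2 * R.gen + R.gen ^ 2, by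
        linear_combination (-3 - 2 * R.gen + R.gen ^ 2 + R.gen ^ 3) * key⟩
    · exact ⟨3 - R.gen - R.gen ^ 2, by
        linear_combination (9 - R.gen - 2 * R.gen ^ 2) * key⟩
  · refine ⟨1, natCast_zmod_ne_zero (by decide), ?_⟩
    have h3 : ((2 : ℕ) : ZMod 7) ≠ 0 := natCast_zmod_ne_zero (by decide)
    have hg : (R.reindex 2 h3).gen = R.gen ^ 2 - 2 := R.E_two_eq
    have hE : R.E 1 = (R.reindex 2 h3).E 3 := by
      rw [reindex_E]
      exact R.E_eq_of_dvd_add (by decide)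
    rw [hE]
    apply mul_ne_sq_of_dvd <;> rw [hg, hsq, unif]
    · exact ⟨2 + R.gen, by
        linear_combination (-1 + R.gen + R.gen ^ 2) * key⟩
    · exact ⟨-R.gen + R.gen ^ 2, by
        linear_combination (-3 + R.gen) * key⟩

end Seven

end RealCyclotomic

namespace RealCyclotomic

/-! ### Elements whose square is at most `3 + gen` -/

section Coefficients

variable {p : ℕ} [NeZero p]

lemma sum_shift (f : ZMod p → ℤ) (k : ZMod p) : ∑ j, f (j - k) = ∑ j, f j :=
  Equiv.sum_comp (Equiv.subRight k) f

lemma sum_sub_shift_sq (a : ZMod p → ℤ) (k : ZMod p) :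
    ∑ j, (a j - a (j - k)) ^ 2 = 2 * (∑ j, a j ^ 2 - ∑ j, a j * a (j - k)) := by
  have h (j : ZMod p) : (a j - a (j - k)) ^ 2 =
      a j ^ 2 + a (j - k) ^ 2 - 2 * (a j * a (j - k)) := by ring
  simp only [h, Finset.sum_sub_distrib, Finset.sum_add_distrib, ← Finset.mul_sum,
    sum_shift (fun j => a j ^ 2)]
  ring

lemma sum_sum_sub_shift_sq (a : ZMod p → ℤ) :
    ∑ k, ∑ j, (a j - a (j - k)) ^ 2 = 2 * (p * ∑ j, a j ^ 2 - (∑ j, a j) ^ 2) := by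
  simp only [sum_sub_shift_sq, ← Finset.mul_sum, Finset.sum_sub_distrib, Finset.sum_const,
    Finset.card_univ, ZMod.card, nsmul_eq_mul]
  rw [Finset.sum_comm]
  simp only [← Finset.mul_sum]
  have h (j : ZMod p) : ∑ k, a (j - k) = ∑ k, a k := Equiv.sum_comp (Equiv.subLeft j) a
  simp only [h, ← Finset.sum_mul, sq]

lemma sum_sq_le_two (hp : 5 < p) {a : ZMod p → ℤ}
    (h : ∀ k, k ≠ 0 → ∑ j, (a j - a (j - k)) ^ 2 < 6)
    (h1 : ∑ j, (a j - a (j - 1)) ^ 2 < 4) (h2 : ∑ j, (a j - a (j - -1)) ^ 2 < 4)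
    (hS : |2 * ∑ j, a j| ≤ p) : ∑ j, a j ^ 2 ≤ 2 := by
  have : Fact (1 < p) := ⟨by omega⟩
  have : Fact (2 < p) := ⟨by omega⟩
  have hle : ∑ k, ∑ j, (a j - a (j - k)) ^ 2 ≤ 4 * p - 8 := by
    have h3 : ∀ k : ZMod p, ∑ j, (a j - a (j - k)) ^ 2 ≤
        4 - (Pi.single 0 4 + Pi.single 1 2 + Pi.single (-1) 2 : ZMod p → ℤ) k := by
      intro k
      have hne : (1 : ZMod p) ≠ -1 := (ZMod.neg_one_ne_one).symm
      rcases eq_or_ne k 0 with rfl | hk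
      · simp
      rcases eq_or_ne k 1 with rfl | hk1
      · have h4 := sum_sub_shift_sq a 1
        simp only [Pi.add_apply, Pi.single_apply, one_ne_zero, hne, if_true, if_false]
        omega
      rcases eq_or_ne k (-1) with rfl | hk2
      · have h4 := sum_sub_shift_sq a (-1)
        simp only [Pi.add_apply, Pi.single_apply, neg_eq_zero, one_ne_zero, hne.symm, if_true,
          if_false]
        omega
      · have h4 := sum_sub_shift_sq a k
        have h5 := h k hk
        simp only [Pi.add_apply, Pi.single_apply, hk, hk1, hk2, if_false]
        omega
    refine (Finset.sum_le_sum fun k _ => h3 k).trans (le_of_eq ?_)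
    simp [Finset.sum_sub_distrib, Finset.sum_add_distrib]
    ring
  rw [sum_sum_sub_shift_sq] at hle
  set T := ∑ j, a j ^ 2
  set S := ∑ j, a j
  have hST : |S| ≤ T := (Finset.abs_sum_le_sum_abs _ _).trans
    (Finset.sum_le_sum fun j _ => by rw [← sq_abs]; exact Int.le_self_sq _)
  have hp' : (5 : ℤ) < p := by exact_mod_cast hp
  rw [abs_mul, abs_two] at hS
  have hS0 := abs_nonneg S
  rw [← sq_abs S] at hle
  generalize |S| = s at *
  have hT : T ≤ 3 := by
    by_contra! hT
    have : s ^ 2 * 2 ≤ p * T := by nlinarith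
    nlinarith
  by_contra! hT2
  have : T = 3 := by omega
  rw [this] at hle hST
  nlinarith

/-- An even function whose values have square sum at most two and whose first differences are
small is supported at `0` or at `± 1 / 2`. -/
lemma eq_zero_or_two_mul_eq (hp : 2 < p) (hpp : p.Prime) {a : ZMod p → ℤ} (ha : ∀ j, a (-j) = a j)
    (h : ∑ j, a j ^ 2 ≤ 2) (h1 : ∑ j, (a j - a (j - 1)) ^ 2 < 4) :
    (∀ j, j ≠ 0 → a j = 0) ∧ (a 0 = 0 ∨ a 0 ^ 2 = 1) ∨
      ∃ i : ZMod p, 2 * i = 1 ∧ ∃ e : ℤ, e ^ 2 = 1 ∧ a = Pi.single i e + Pi.single (-i) e := by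
  have : Fact p.Prime := ⟨hpp⟩
  have : Fact (2 < p) := ⟨hp⟩
  by_cases hi : ∃ i, i ≠ 0 ∧ a i ≠ 0
  · right
    obtain ⟨i, hi0, hai⟩ := hi
    have h2 : (2 : ZMod p) ≠ 0 := by
      have : ((2 : ℕ) : ZMod p) ≠ 0 := by
        rw [Ne, ZMod.natCast_eq_zero_iff]
        exact Nat.not_dvd_of_pos_of_lt two_pos hp
      exact_mod_cast this
    have hne : i ≠ -i := fun h => hi0 ((mul_eq_zero.1 (by linear_combination h)).resolve_left h2)
    have hpos : 0 < a i ^ 2 := by positivity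
    have hle : ∀ s : Finset (ZMod p), ∑ j ∈ s, a j ^ 2 ≤ 2 := fun s =>
      (Finset.sum_le_sum_of_subset_of_nonneg (Finset.subset_univ s)
        fun _ _ _ => sq_nonneg _).trans h
    have he : a i ^ 2 = 1 := by
      have h3 := hle {i, -i}
      rw [Finset.sum_pair hne, ha] at h3
      omega
    have h0 : ∀ j, j ≠ i → j ≠ -i → a j = 0 := fun j hj hj' => by
      have h3 := hle {j, i, -i}
      rw [Finset.sum_insert (by simp [hj, hj']), Finset.sum_pair hne, ha, he] at h3
      exact pow_eq_zero_iff two_ne_zero |>.1 (le_antisymm (by linarith) (sq_nonneg _))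
    have hae : a = Pi.single i (a i) + Pi.single (-i) (a i) := by
      funext j
      rcases eq_or_ne j i with rfl | hj
      · simp [hne]
      rcases eq_or_ne j (-i) with rfl | hj'
      · simp [hne.symm, ha]
      · simp [hj, hj', h0]
    by_cases hi1 : 2 * i = 1
    · exact ⟨i, hi1, a i, he, hae⟩
    by_cases hi2 : 2 * -i = 1
    · exact ⟨-i, hi2, a i, he, by rwa [neg_neg, add_comm]⟩
    have h3 : ∑ j, a j * a (j - 1) = a i * a (i - 1) + a (-i) * a (-i - 1) := by
      conv_lhs => enter [2, j]; rw [show a j = (Pi.single i (a i) + Pi.single (-i) (a i)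
        : ZMod p → ℤ) j by rw [← hae]]
      simp [add_mul, Finset.sum_add_distrib, Pi.single_apply, ha]
    rw [sum_sub_shift_sq, h3, h0 (i - 1) (by simp) fun h => hi1 (by linear_combination h),
      h0 (-i - 1) (fun h => hi2 (by linear_combination h)) (by simp)] at h1
    have h4 := Finset.sum_le_sum_of_subset_of_nonneg (Finset.subset_univ {i, -i})
        fun j _ _ => sq_nonneg (a j)
    rw [Finset.sum_pair hne, ha, he] at h4
    omega
  · left
    push Not at hi
    refine ⟨hi, ?_⟩
    rw [Finset.sum_eq_single 0 (fun j _ hj => by rw [hi j hj]; rfl) (by simp)] at h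
    have h3 : a 0 ≤ 1 := by nlinarith
    have h4 : -1 ≤ a 0 := by nlinarith
    interval_cases a 0 <;> simp

end Coefficients

variable {p : ℕ} [Fact p.Prime] {O : Type*} [CommRing O] (R : RealCyclotomic p O)

lemma exists_coeff_abs_sum_le (x : O) :
    ∃ a : ZMod p → ℤ, (∀ j, a (-j) = a j) ∧ |2 * ∑ j, a j| ≤ p ∧
      ∀ t, t ≠ 0 → (R.emb t x : ℂ) = intFourier a t := by
  obtain ⟨a, ha, h1, -⟩ := R.exists_two_mul_eq_sum x
  have hp0 : 0 < p := (Fact.out : p.Prime).pos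
  obtain ⟨c, hc⟩ : ∃ c : ℤ, |2 * (∑ j, a j - p * c)| ≤ p := by
    have hp0' : (0 : ℤ) < 2 * p := by positivity
    refine ⟨(2 * ∑ j, a j + p) / (2 * p), ?_⟩
    have h2 := Int.emod_add_mul_ediv (2 * ∑ j, a j + p) (2 * p)
    have h3 := Int.emod_nonneg (2 * ∑ j, a j + p) hp0'.ne'
    have h4 := Int.emod_lt_of_pos (2 * ∑ j, a j + p) hp0'
    rw [abs_le]
    constructor <;> linarith
  refine ⟨fun j => a j - c, fun j => by simp [ha], ?_, fun t ht => ?_⟩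
  · simpa [Finset.sum_sub_distrib] using hc
  · rw [h1 t ht]
    have h3 := AddChar.sum_mulShift t (ZMod.isPrimitive_stdAddChar p)
    simp only [ht, if_false, mul_comm _ t, Nat.cast_zero] at h3
    simp only [intFourier, Int.cast_sub, sub_mul, Finset.sum_sub_distrib, ← Finset.mul_sum]
    rw [h3, mul_zero, sub_zero]

lemma sq_ne_three_add_gen (hp : p ≠ 2) [IsDomain O] (x : O) : x ^ 2 ≠ 3 + R.gen := by
  intro hx
  have hg := R.rootUnit_sq hp
  set g := R.rootUnit
  have h1 : ((2 : ℕ) : O) ∣ x - g - 1 := by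
    refine R.natCast_dvd_of_dvd_pow Nat.prime_two hp.symm ⟨1 + g ^ 2 - x * g - x + g, ?_⟩
    push_cast
    linear_combination hx - hg
  obtain ⟨y, hy⟩ := h1
  have h2 : (2 : O) ≠ 0 := by exact_mod_cast R.natCast_ne_zero two_ne_zero
  push_cast at hy
  have h3 : g = 2 * (-y * (1 + g) - y ^ 2) := by
    refine mul_left_cancel₀ h2 ?_
    linear_combination hx - hg - (x + 1 + g + 2 * y) * hy
  refine R.natCast_not_isUnit le_rfl (isUnit_of_dvd_unit ?_ (R.isUnit_rootUnit hp))
  exact_mod_cast Dvd.intro _ h3.symm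

lemma eq_zero_or_sq_eq_of_sq_le [IsDomain O] (hp : 5 < p) {x : O}
    (h : ∀ t, t ≠ 0 → R.emb t x ^ 2 ≤ 3 + R.emb t R.gen) :
    x = 0 ∨ x ^ 2 = 1 ∨ x ^ 2 = 2 + R.gen := by
  have hp2 : p ≠ 2 := by omega
  have : Fact (2 < p) := ⟨by omega⟩
  have : Fact (1 < p) := ⟨by omega⟩
  have hlt : ∀ t, t ≠ 0 → R.emb t x ^ 2 < 3 + R.emb t R.gen := fun t ht =>
    (h t ht).lt_of_ne fun he => R.sq_ne_three_add_gen hp2 x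
      (R.emb_injective t ht (by rw [map_pow, he, map_add, map_ofNat]))
  obtain ⟨a, ha, hS, hx⟩ := R.exists_coeff_abs_sum_le x
  have key : ∀ k : ZMod p, k ≠ 0 → ∑ j, (a j - a (j - k)) ^ 2 <
      6 - 2 * ((Pi.single 0 1 + Pi.single 1 1 : ZMod p → ℤ) (-k) +
        (Pi.single 0 1 + Pi.single 1 1 : ZMod p → ℤ) (1 - k)) := by
    intro k hk
    have h1 := sum_sq_intConv_lt (a := a) (b := Pi.single 0 1)
      (c := Pi.single 0 1 + Pi.single 1 1) (m := Pi.single 0 1 - Pi.single k 1) (by simp)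
      (fun h0 => by
        have := congrFun h0 0
        simp [hk.symm] at this) fun t ht => by
        rw [intFourier_add, intFourier_single, intFourier_single, mul_zero, mul_one,
          AddChar.map_zero_eq_one, ← R.emb_two_add_gen ht, ← hx t ht, Complex.normSq_ofReal,
          Complex.normSq_one, map_add, map_ofNat]
        linarith [hlt t ht]
    simp only [intConv_sub, intConv_single, sub_zero] at h1
    rw [sum_sub_shift_sq (Pi.single 0 1), sum_sub_shift_sq (Pi.single 0 1 + Pi.single 1 1)] at h1
    set c : ZMod p → ℤ := Pi.single 0 1 + Pi.single 1 1 with hc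
    have h2 (f : ZMod p → ℤ) : ∑ i, c i * f i = f 0 + f 1 := by
      simp [hc, add_mul, Finset.sum_add_distrib, Pi.single_apply]
    have h3 := h2 fun i => c (i - k)
    rw [zero_sub] at h3
    have h4 : ∑ i, c i ^ 2 = 2 := by
      simp only [sq, h2]
      simp [hc]
    have h5 : ∑ j, (Pi.single 0 1 : ZMod p → ℤ) j ^ 2 = 1 := by simp [Pi.single_apply]
    have h6 : ∑ j, (Pi.single 0 1 : ZMod p → ℤ) j * (Pi.single 0 1 : ZMod p → ℤ) (j - k) = 0 := by
      rw [Finset.sum_eq_single 0 (fun j _ hj => by simp [hj]) (by simp)]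
      simp [hk]
    rw [h3, h4, h5, h6] at h1
    linarith
  have hN1 : ∑ j, (a j - a (j - 1)) ^ 2 < 4 := by
    have := key 1 one_ne_zero
    simpa [Pi.single_apply, ZMod.neg_one_ne_one] using this
  have hN2 : ∑ j, (a j - a (j - -1)) ^ 2 < 4 := by
    refine (key (-1) (by simp)).trans_le ?_
    simp only [neg_neg, Pi.add_apply, Pi.single_eq_same, Pi.single_apply]
    split_ifs <;> norm_num
  have hN : ∀ k, k ≠ 0 → ∑ j, (a j - a (j - k)) ^ 2 < 6 := by
    intro k hk
    refine (key k hk).trans_le ?_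
    simp only [Pi.add_apply, Pi.single_apply]
    split_ifs <;> norm_num
  have hT := sum_sq_le_two hp hN hN1 hN2 hS
  rcases eq_zero_or_two_mul_eq (by omega) Fact.out ha hT hN1 with ⟨h0, h1⟩ | ⟨i, hi, e, he, rfl⟩
  · have hxa : x = a 0 := by
      refine R.ext_emb_complex fun t ht => ?_
      rw [hx t ht, intFourier, Finset.sum_eq_single 0 (fun j _ hj => by simp [h0 j hj]) (by simp)]
      simp
    rcases h1 with h1 | h1
    · left; simp [hxa, h1]
    · right; left; rw [hxa]; exact_mod_cast congrArg (Int.cast (R := O)) h1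
  · right; right
    refine R.ext_emb_complex fun t ht => ?_
    have he' : (e : ℂ) ^ 2 = 1 := by exact_mod_cast he
    have h1 : ∀ i : ZMod p, intFourier (Pi.single i e) t = e * χ (t * i) := by
      intro i
      rw [intFourier, Finset.sum_eq_single i]
      · simp
      · intro b _ hb
        simp [Pi.single_eq_of_ne hb]
      · simp
    rw [map_pow, Complex.ofReal_pow, hx t ht, intFourier_add, h1, h1, map_add, map_ofNat,
      Complex.ofReal_add, R.emb_gen t ht]
    have h2 : (χ (t * i) : ℂ) * χ (t * i) = χ t := by
      rw [← AddChar.map_add_eq_mul]; congr 1; linear_combination t * hi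
    have h3 : (χ (t * -i) : ℂ) * χ (t * -i) = χ (-t) := by
      rw [← AddChar.map_add_eq_mul]; congr 1; linear_combination -t * hi
    have h4 : (χ (t * i) : ℂ) * χ (t * -i) = 1 := by
      rw [← AddChar.map_add_eq_mul, ← AddChar.map_zero_eq_one (ZMod.stdAddChar (N := p))]; congr 1; ring
    push_cast
    linear_combination he' * (2 + χ t + χ (-t)) + e ^ 2 * (h2 + h3 + 2 * h4)

end RealCyclotomic

namespace RealCyclotomic

/-! ### Ternary forms -/

section Gram

variable {O : Type*} [CommRing O] [IsDomain O]

/-- The Gram determinant of three vectors orthogonal to a unit vector in rank three vanishes. -/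
lemma gram_eq_zero {B : LinearMap.BilinForm O (Fin 3 → O)} (hs : ∀ u v, B u v = B v u)
    {v₀ : Fin 3 → O} (h₀ : B v₀ v₀ = 1) {u v w : Fin 3 → O} (hu : B u v₀ = 0) (hv : B v v₀ = 0)
    (hw : B w v₀ = 0) :
    B u u * B v v * B w w + 2 * B u v * B u w * B v w - B u u * B v w ^ 2 - B v v * B u w ^ 2 -
      B w w * B u v ^ 2 = 0 := by
  have hdep : ¬ LinearIndependent O ![v₀, u, v, w] := fun h => by
    have := h.fintype_card_le_finrank
    simp at this
  obtain ⟨c, hc, i, hi⟩ := Fintype.not_linearIndependent_iff.1 hdep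
  simp only [Fin.sum_univ_four, Matrix.cons_val] at hc
  have key (x : Fin 3 → O) : c 0 * B v₀ x + c 1 * B u x + c 2 * B v x + c 3 * B w x = 0 := by
    have := congrArg (fun y => B y x) hc
    simpa using this
  have h0 := key v₀
  rw [h₀, hu, hv, hw] at h0
  have hc0 : c 0 = 0 := by linear_combination h0
  have h1 := key u
  have h2 := key v
  have h3 := key w
  rw [hc0] at h1 h2 h3
  rw [hs v u, hs w u] at h1
  rw [hs w v] at h2
  have hdet : Matrix.det !![B u u, B u v, B u w; B u v, B v v, B v w; B u w, B v w, B w w] = 0 := by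
    refine Matrix.exists_mulVec_eq_zero_iff.1 ⟨![c 1, c 2, c 3], fun hz => hi ?_, ?_⟩
    · have e1 : c 1 = 0 := congrFun hz 0
      have e2 : c 2 = 0 := congrFun hz 1
      have e3 : c 3 = 0 := congrFun hz 2
      fin_cases i
      exacts [hc0, e1, e2, e3]
    · funext j
      fin_cases j <;> simp [Matrix.mulVec, dotProduct, Fin.sum_univ_three]
      · linear_combination h1
      · linear_combination h2
      · linear_combination h3
  rw [Matrix.det_fin_three] at hdet
  simp at hdet
  linear_combination hdet

end Gram

lemma emb_form_nonneg {p : ℕ} [Fact p.Prime] {O : Type*} [CommRing O] (R : RealCyclotomic p O)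
    {B : LinearMap.BilinForm O (Fin 3 → O)}
    (hpos : ∀ v, v ≠ 0 → ∀ t, t ≠ 0 → 0 < R.emb t (B v v)) (v : Fin 3 → O) {t : ZMod p} (ht : t ≠ 0) : 0 ≤ R.emb t (B v v) := by
  rcases eq_or_ne v 0 with rfl | hv
  · simp
  · exact (hpos v hv t ht).le

variable {p : ℕ} [Fact p.Prime] {O : Type*} [CommRing O] [IsDomain O] (R : RealCyclotomic p O)

section Form

variable {B : LinearMap.BilinForm O (Fin 3 → O)} (hs : ∀ u v, B u v = B v u)
  (hpos : ∀ v, v ≠ 0 → ∀ t, t ≠ 0 → 0 < R.emb t (B v v))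
include hs

lemma mul_eq_sq_of_perp {v₀ v w u : Fin 3 → O} {α : O} (h₀ : B v₀ v₀ = 1)
    (hv₀ : B v v₀ = 0) (hv : B v v = R.unif) (hw₀ : B w v₀ = 0) (hw : B w w = 2)
    (hu₀ : B u v₀ = 0) (hu : B u u = α) :
    (2 * R.unif - B w v ^ 2) * (2 * α - B w u ^ 2) = (2 * B v u - B w v * B w u) ^ 2 := by
  have hG := gram_eq_zero hs h₀ hw₀ hv₀ hu₀
  rw [hw, hv, hu] at hG
  linear_combination 2 * hG

lemma not_exists_perp_of_eq_zero (hp : 5 < p) {v₀ v w u : Fin 3 → O} (h₀ : B v₀ v₀ = 1)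
    (hv₀ : B v v₀ = 0) (hv : B v v = R.unif) (hw₀ : B w v₀ = 0) (hw : B w w = 2)
    (hwv : B w v = 0) (hu₀ : B u v₀ = 0) : B u u ≠ 3 + R.gen := by
  intro hu
  have hp2 : p ≠ 2 := by omega
  have hπ := R.unif_prime hp2
  have h2 : (2 : O) ≠ 0 := by exact_mod_cast R.natCast_ne_zero two_ne_zero
  have hG := gram_eq_zero hs h₀ hw₀ hv₀ hu₀
  rw [hw, hv, hu, hwv] at hG
  have hgen : R.gen = 2 - R.unif := by rw [unif]; ring
  have hdvd : R.unif ∣ 2 * B v u ^ 2 :=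
    ⟨2 * (3 + R.gen) - B w u ^ 2, by linear_combination -hG⟩
  have h2' : ¬ R.unif ∣ 2 := by
    exact_mod_cast R.not_unif_dvd_natCast hp2 (m := 2)
      (Nat.not_dvd_of_pos_of_lt two_pos (by omega))
  obtain ⟨c, hc⟩ := hπ.dvd_of_dvd_pow ((hπ.dvd_or_dvd hdvd).resolve_left h2')
  have h3 : B w u ^ 2 = 2 * (3 + R.gen - R.unif * c ^ 2) := by
    refine mul_left_cancel₀ hπ.ne_zero ?_
    rw [hc] at hG
    linear_combination -hG
  obtain ⟨d, hd⟩ := R.natCast_dvd_of_dvd_pow Nat.prime_two hp2.symm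
    (by rw [Nat.cast_ofNat]; exact Dvd.intro _ h3.symm : ((2 : ℕ) : O) ∣ B w u ^ 2)
  rw [Nat.cast_ofNat] at hd
  have h4 : 3 + R.gen = R.unif * c ^ 2 + 2 * d ^ 2 := by
    refine mul_left_cancel₀ h2 ?_
    rw [hd] at h3
    linear_combination -h3
  rcases R.eq_zero_or_sq_eq_one hp (x := d) fun t ht => by
    have h5 := congrArg (R.emb t) h4
    simp only [map_add, map_mul, map_pow, map_ofNat] at h5
    have := R.emb_gen_lt ht
    nlinarith [mul_nonneg (R.emb_unif_pos ht).le (sq_nonneg (R.emb t c))] with hd | hd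
  · refine R.not_unif_dvd_natCast hp2 (m := 5) (Nat.not_dvd_of_pos_of_lt (by norm_num) hp)
      ⟨c ^ 2 + 1, ?_⟩
    rw [hd, hgen] at h4
    push_cast
    linear_combination h4
  · refine R.not_unif_dvd_natCast hp2 (m := 3) (Nat.not_dvd_of_pos_of_lt (by norm_num)
      (by omega)) ⟨c ^ 2 + 1, ?_⟩
    rw [hd, hgen] at h4
    push_cast
    linear_combination h4

include hpos

lemma emb_form_sq_le (u v : Fin 3 → O) {t : ZMod p} (ht : t ≠ 0) :
    R.emb t (B u v) ^ 2 ≤ R.emb t (B u u) * R.emb t (B v v) := by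
  rcases eq_or_ne v 0 with rfl | hv
  · simp
  · have h := R.emb_form_nonneg hpos (B v v • u - B u v • v) ht
    have h1 : B (B v v • u - B u v • v) (B v v • u - B u v • v) =
        B v v * (B u u * B v v - B u v ^ 2) := by
      simp only [map_sub, map_smul, LinearMap.sub_apply, LinearMap.smul_apply, smul_eq_mul, hs v u]
      ring
    rw [h1, map_mul] at h
    have h2 := nonneg_of_mul_nonneg_right h (hpos v hv t ht)
    rw [map_sub, map_mul, map_pow] at h2
    linarith

lemma exists_perp (huniv : ∀ α, (∀ t, t ≠ 0 → 0 < R.emb t α) → ∃ v, B v v = α)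
    {v₀ : Fin 3 → O} (h₀ : B v₀ v₀ = 1) {α : O} (hα : ∀ t, t ≠ 0 → 0 < R.emb t α) :
    ∃ u x, B u v₀ = 0 ∧ B u u = α - x ^ 2 ∧ ∀ t, t ≠ 0 → R.emb t x ^ 2 ≤ R.emb t α := by
  obtain ⟨v, hv⟩ := huniv α hα
  have h1 : B (v - B v v₀ • v₀) (v - B v v₀ • v₀) = α - B v v₀ ^ 2 := by
    simp only [map_sub, map_smul, LinearMap.sub_apply, LinearMap.smul_apply, smul_eq_mul, hs v₀ v,
      h₀, hv]
    ring
  refine ⟨v - B v v₀ • v₀, B v v₀, by simp [h₀], h1, fun t ht => ?_⟩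
  have h2 := R.emb_form_sq_le hs hpos v v₀ ht
  simpa [h₀, hv] using h2

lemma not_exists_orthonormal (hp : 5 < p)
    (huniv : ∀ α, (∀ t, t ≠ 0 → 0 < R.emb t α) → ∃ v, B v v = α)
    {v₀ v v₁ : Fin 3 → O} (h₀ : B v₀ v₀ = 1) (hv₀ : B v v₀ = 0) (hv : B v v = R.unif)
    (hv₁₀ : B v₁ v₀ = 0) : B v₁ v₁ ≠ 1 := by
  intro hv₁
  have hp2 : p ≠ 2 := by omega
  have hvv₁ : B v v₁ = 0 := by
    refine R.eq_zero_of_sq_le_unif hp fun t ht => ?_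
    simpa [hv, hv₁] using R.emb_form_sq_le hs hpos v v₁ ht
  obtain ⟨u, x, hu₀, hu, hx⟩ := R.exists_perp hs hpos huniv h₀ (α := 3) fun t _ => by
    rw [map_ofNat]
    exact three_pos
  have hx' := R.eq_zero_or_sq_eq_one hp (x := x) fun t ht => by
    simpa [map_ofNat] using hx t ht
  have hy' := R.eq_zero_or_sq_eq_one hp (x := B u v₁) fun t ht => by
    have h1 := R.emb_form_sq_le hs hpos u v₁ ht
    rw [hv₁, hu, map_one, mul_one, map_sub, map_ofNat, map_pow] at h1
    nlinarith [sq_nonneg (R.emb t x)]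
  have hG := gram_eq_zero hs h₀ hv₁₀ hu₀ hv₀
  rw [hs v₁ v, hvv₁, hv₁, hv, hu, hs v₁ u] at hG
  have hπ := R.unif_prime hp2
  have h1 : R.unif * (3 - x ^ 2 - B u v₁ ^ 2) = B u v ^ 2 := by linear_combination hG
  obtain ⟨z, hz⟩ := hπ.dvd_of_dvd_pow (Dvd.intro _ h1)
  have h2 : R.unif ∣ 3 - x ^ 2 - B u v₁ ^ 2 := by
    refine ⟨z ^ 2, mul_left_cancel₀ hπ.ne_zero ?_⟩
    rw [h1, hz]
    ring
  have h3 : ∃ m : ℕ, 0 < m ∧ m < p ∧ 3 - x ^ 2 - B u v₁ ^ 2 = (m : O) := by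
    rcases hx' with rfl | hx' <;> rcases hy' with hy' | hy'
    · exact ⟨3, by norm_num, by omega, by rw [hy']; norm_num⟩
    · exact ⟨2, by norm_num, by omega, by rw [hy']; norm_num⟩
    · exact ⟨2, by norm_num, by omega, by rw [hx', hy']; norm_num⟩
    · exact ⟨1, by norm_num, by omega, by rw [hx', hy']; norm_num⟩
  obtain ⟨m, hm0, hmp, hm⟩ := h3
  exact R.not_unif_dvd_natCast hp2 (Nat.not_dvd_of_pos_of_lt hm0 hmp) (hm ▸ h2)

lemma exists_perp_three_add_gen (hp : 5 < p)
    (huniv : ∀ α, (∀ t, t ≠ 0 → 0 < R.emb t α) → ∃ v, B v v = α)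
    {v₀ : Fin 3 → O} (h₀ : B v₀ v₀ = 1) (hone : ∀ u, B u v₀ = 0 → B u u ≠ 1) :
    ∃ u, B u v₀ = 0 ∧ B u u = 3 + R.gen := by
  have hp2 : p ≠ 2 := by omega
  obtain ⟨u, x, hu₀, hu, hx⟩ := R.exists_perp hs hpos huniv h₀ (α := 3 + R.gen) fun t ht => by
    rw [map_add, map_ofNat]
    linarith [R.neg_two_le_emb_gen ht]
  rcases R.eq_zero_or_sq_eq_of_sq_le hp (x := x) fun t ht => by
      simpa [map_ofNat] using hx t ht with rfl | hx | hx
  · exact ⟨u, hu₀, by rw [hu]; ring⟩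
  · obtain ⟨g, hg⟩ := (R.isUnit_rootUnit hp2).exists_left_inv
    refine (hone (g • u) (by simp [hu₀]) ?_).elim
    simp only [map_smul, LinearMap.smul_apply, smul_eq_mul, hu, hx]
    linear_combination (g * R.rootUnit + 1) * hg - g ^ 2 * R.rootUnit_sq hp2
  · exact (hone u hu₀ (by rw [hu, hx]; ring)).elim

theorem not_universal (hp : 5 < p) :
    ¬ ∀ α, (∀ t, t ≠ 0 → 0 < R.emb t α) → ∃ v, B v v = α := by
  intro huniv
  obtain ⟨v₀, h₀⟩ := huniv 1 fun t _ => by simp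
  obtain ⟨v, x, hv₀, hv, hx⟩ := R.exists_perp hs hpos huniv h₀ (α := R.unif) fun t ht =>
    R.emb_unif_pos ht
  obtain rfl := R.eq_zero_of_sq_le_unif hp hx
  replace hv : B v v = R.unif := by rw [hv]; ring
  have hone : ∀ u, B u v₀ = 0 → B u u ≠ 1 := fun u hu =>
    R.not_exists_orthonormal hs hpos hp huniv h₀ hv₀ hv hu
  obtain ⟨w, x, hw₀, hw, hx⟩ := R.exists_perp hs hpos huniv h₀ (α := 2) fun t _ => by
    rw [map_ofNat]
    exact two_pos
  rcases R.eq_zero_or_sq_eq_one hp (x := x) fun t ht => (hx t ht).trans (by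
      rw [map_ofNat]
      norm_num) with rfl | hx
  swap
  · exact hone w hw₀ (by rw [hw, hx]; norm_num)
  replace hw : B w w = 2 := by rw [hw]; ring
  have hb : ∀ t, t ≠ 0 → R.emb t (B w v) ^ 2 < 2 * R.emb t R.unif := fun t ht => by
    have h1 := R.emb_form_sq_le hs hpos w v ht
    rw [hw, hv, map_ofNat] at h1
    refine h1.lt_of_ne fun he => R.sq_ne_two_mul_unif hp (B w v) (R.emb_injective t ht ?_)
    rw [map_pow, he, map_mul, map_ofNat]
  rcases eq_or_ne (B w v) 0 with hb0 | hb0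
  · obtain ⟨u, hu₀, hu⟩ := R.exists_perp_three_add_gen hs hpos hp huniv h₀ hone
    exact R.not_exists_perp_of_eq_zero hs hp h₀ hv₀ hv hw₀ hw hb0 hu₀ hu
  · obtain rfl | hp7 : p = 7 ∨ 7 < p := by
      have hprime : p.Prime := Fact.out
      have h6 : p ≠ 6 := by
        rintro rfl
        revert hprime
        decide
      omega
    · obtain ⟨k, hk, hk'⟩ := R.exists_forall_mul_ne_sq_of_sq_lt hb0 hb
      obtain ⟨u, hu₀, hu⟩ := (R.reindex k hk).exists_perp_three_add_gen hs
        (fun v hv t ht => hpos v hv _ (mul_ne_zero ht (inv_ne_zero hk))) hp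
        (fun α hα => huniv α ((R.forall_emb_reindex hk (P := fun f => 0 < f α)).1 hα)) h₀ hone
      exact hk' _ _ (R.mul_eq_sq_of_perp hs h₀ hv₀ hv hw₀ hw hu₀ hu)
    · exact hb0 (R.eq_zero_of_sq_lt_two_mul_unif hp7 hb)

end Form

end RealCyclotomic

end

/-- Let `p > 5` be a prime. There is no classical totally positive definite ternary quadratic
form that is universal over `𝓞_{K_p}`. -/
theorem stmt19 (p : ℕ) (hp : p.Prime) (hp5 : 5 < p) :
    ¬ ∃ M : Matrix (Fin 3) (Fin 3) (𝓞 ↥(Kq p)), M.IsSymm ∧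
        (∀ v : Fin 3 → 𝓞 ↥(Kq p), v ≠ 0 → TotallyPositive ↥(Kq p) (evalQF M v)) ∧
        (∀ α : 𝓞 ↥(Kq p), TotallyPositive ↥(Kq p) α →
          ∃ v : Fin 3 → 𝓞 ↥(Kq p), evalQF M v = α) := by
  rintro ⟨M, hM, hpos, huniv⟩
  have : Fact p.Prime := ⟨hp⟩
  obtain ⟨R, hR⟩ := exists_realCyclotomic p
  have hB : ∀ v, Matrix.toBilin' M v v = evalQF M v := fun v => Matrix.toBilin'_apply M v v
  refine R.not_universal (B := Matrix.toBilin' M) (fun u v => ?_) (fun v hv => ?_) hp5 fun α hα => ?_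
  · rw [Matrix.toBilin'_apply, Matrix.toBilin'_apply, Finset.sum_comm]
    refine Finset.sum_congr rfl fun i _ => Finset.sum_congr rfl fun j _ => ?_
    rw [hM.apply]
    ring
  · rw [hB]
    exact (hR _).1 (hpos v hv)
  · obtain ⟨v, hv⟩ := huniv α ((hR α).2 hα)
    exact ⟨v, (hB v).trans hv⟩
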